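/- arXiv:1907.03350 — 3 statements merged into one kernel-verified Lean document; each statement's English description precedes it below -/
import Mathlib

section
/- Let F be a finite field with q elements. Then, as rational numbers, (q · #{γ ∈ SL₂(F) : trace(γ) = 2} − #SL₂(F)) / #SL₂(F) = 1/(q² − 1). (In particular #SL₂(F) = q³ − q and #{γ ∈ SL₂(F) : trace(γ) = 2} = q².) -/
open Classical in
noncomputable def slEquiv (F : Type*) [Field F] :
    Matrix.SpecialLinearGroup (Fin 2) F ≃ {p : F × F // p ≠ 0} × F where
  toFun γ := (⟨(γ.1 0 0, γ.1 0 1), by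
    intro h
    have h1 := γ.2
    rw [Matrix.det_fin_two] at h1
    simp only [Prod.mk_eq_zero] at h
    simp [h.1, h.2] at h1⟩, if γ.1 0 0 = 0 then γ.1 1 1 else γ.1 1 0)
  invFun p := if h : p.1.1.1 = 0 then
      ⟨!![0, p.1.1.2; -(p.1.1.2)⁻¹, p.2], by
        have : p.1.1.2 ≠ 0 := fun h' => p.1.2 (Prod.ext h h')
        simp [Matrix.det_fin_two, this]⟩
    else ⟨!![p.1.1.1, p.1.1.2; p.2, (1 + p.1.1.2 * p.2) / p.1.1.1], by
        simp [Matrix.det_fin_two]; field_simp; ring⟩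
  left_inv γ := by
    have h1 := γ.2
    rw [Matrix.det_fin_two] at h1
    by_cases h : γ.1 0 0 = 0
    · have hb : γ.1 0 1 ≠ 0 := by intro hb; simp [h, hb] at h1
      apply Subtype.ext
      ext i j
      fin_cases i <;> fin_cases j <;> simp [h]
      rw [h] at h1
      field_simp
      linear_combination h1
    · apply Subtype.ext
      ext i j
      fin_cases i <;> fin_cases j <;> simp [h]
      field_simp
      linear_combination -h1
  right_inv p := by
    obtain ⟨⟨⟨a, b⟩, hp⟩, t⟩ := p
    by_cases h : a = 0 <;> simp [h]

open Classical in
noncomputable def trEquiv (F : Type*) [Field F] :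
    {γ : Matrix.SpecialLinearGroup (Fin 2) F //
          Matrix.trace (γ : Matrix (Fin 2) (Fin 2) F) = 2} ≃ F × F where
  toFun γ := (γ.1.1 0 1, if γ.1.1 0 1 = 0 then γ.1.1 1 0 else γ.1.1 0 0 - 1)
  invFun p := if h : p.1 = 0 then
      ⟨⟨!![1, 0; p.2, 1], by simp [Matrix.det_fin_two]⟩, by
        simp [Matrix.trace_fin_two]; norm_num⟩
    else ⟨⟨!![1 + p.2, p.1; -p.2 ^ 2 / p.1, 1 - p.2], by
        simp [Matrix.det_fin_two]; field_simp; ring⟩, by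
        simp [Matrix.trace_fin_two]; norm_num⟩
  left_inv γ := by
    have h1 := γ.1.2
    have h2 := γ.2
    rw [Matrix.det_fin_two] at h1
    rw [Matrix.trace_fin_two] at h2
    have hd : γ.1.1 1 1 = 2 - γ.1.1 0 0 := by linear_combination h2
    by_cases h : γ.1.1 0 1 = 0
    · have ha : γ.1.1 0 0 = 1 := by
        rw [hd, h] at h1
        have : (γ.1.1 0 0 - 1) ^ 2 = 0 := by linear_combination -h1
        exact sub_eq_zero.1 (pow_eq_zero_iff (two_ne_zero) |>.1 this)
      have hd' : γ.1.1 1 1 = 1 := by rw [hd, ha]; norm_num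
      apply Subtype.ext
      apply Subtype.ext
      ext i j
      fin_cases i <;> fin_cases j <;> simp [h, ha, hd']
    · rw [hd] at h1
      apply Subtype.ext
      apply Subtype.ext
      ext i j
      fin_cases i <;> fin_cases j <;> simp [h]
      · field_simp
        linear_combination h1
      · rw [hd]; ring
  right_inv p := by
    obtain ⟨b, t⟩ := p
    by_cases h : b = 0 <;> simp [h]

/-- For a finite field `F` with `q` elements,
`(q · #{γ ∈ SL₂(F) : tr γ = 2} − #SL₂(F)) / #SL₂(F) = 1/(q² − 1)` in `ℚ`. -/
theorem stmt1 (F : Type*) [Field F] [Fintype F] :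
    ((Fintype.card F : ℚ) *
        (Nat.card {γ : Matrix.SpecialLinearGroup (Fin 2) F //
          Matrix.trace (γ : Matrix (Fin 2) (Fin 2) F) = 2} : ℚ)
      - (Nat.card (Matrix.SpecialLinearGroup (Fin 2) F) : ℚ))
      / (Nat.card (Matrix.SpecialLinearGroup (Fin 2) F) : ℚ)
      = 1 / ((Fintype.card F : ℚ) ^ 2 - 1) := by
  classical
  have hS : Nat.card (Matrix.SpecialLinearGroup (Fin 2) F)
      = (Fintype.card F * Fintype.card F - 1) * Fintype.card F := by
    rw [Nat.card_congr (slEquiv F), Nat.card_prod, Nat.card_eq_fintype_card,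
      Nat.card_eq_fintype_card, Fintype.card_subtype_compl]
    simp
  have hT : Nat.card {γ : Matrix.SpecialLinearGroup (Fin 2) F //
      Matrix.trace (γ : Matrix (Fin 2) (Fin 2) F) = 2} = Fintype.card F * Fintype.card F := by
    rw [Nat.card_congr (trEquiv F), Nat.card_prod, Nat.card_eq_fintype_card]
  have hq : 1 < Fintype.card F := Fintype.one_lt_card
  have hle : 1 ≤ Fintype.card F * Fintype.card F := by nlinarith
  rw [hS, hT]
  push_cast [Nat.cast_sub hle]
  have hq' : (1 : ℚ) < Fintype.card F := by exact_mod_cast hq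
  generalize (Fintype.card F : ℚ) = q at hq'
  have h0 : q ≠ 0 := by positivity
  have h1 : q ^ 2 - 1 ≠ 0 := by nlinarith
  have h2 : q * q - 1 = q ^ 2 - 1 := by ring
  rw [h2]
  field_simp
  ring
end

section
/- There is a constant C > 0 such that for all real n ≥ 3, |∑_{𝔭} 1/N(𝔭) − log log n| ≤ C, where the sum ranges over all nonzero prime ideals 𝔭 of ℤ[i] with absolute norm N(𝔭) ≤ n. -/
namespace GMert
open Finset ArithmeticFunction

lemma dirichlet_bound (E g : ℕ → ℝ) (C : ℝ) (M : ℕ) (hE : ∀ k, |E k| ≤ C)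
    (hg0 : ∀ k, 0 ≤ g k) (hg : ∀ k, M ≤ k → g (k + 1) ≤ g k) (N : ℕ) (hN : M ≤ N) :
    |∑ k ∈ Ioc M N, (E k - E (k - 1)) * g k| ≤ 2 * C * g M := by
  have key : |∑ k ∈ Ioc M N, (E k - E (k - 1)) * g k - E N * g N| ≤ C * (2 * g M - g N) := by
    induction N, hN using Nat.le_induction with
    | base =>
      simp only [Ioc_self, sum_empty, zero_sub, abs_neg, abs_mul, abs_of_nonneg (hg0 M)]
      nlinarith [hE M, hg0 M]
    | succ n hn ih =>
      rw [sum_Ioc_succ_top (by omega)]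
      simp only [Nat.add_sub_cancel]
      have h1 := hE n
      have h2 := hg n hn
      rw [abs_le] at *
      constructor <;> nlinarith
  have h1 := hE N
  have h2 := hg0 N
  rw [abs_le] at *
  constructor <;> nlinarith

/-- The nontrivial character mod 4, real valued. -/
noncomputable def ch (n : ℕ) : ℝ := ((ZMod.χ₄ (n : ZMod 4) : ℤ) : ℝ)

lemma ch_eq (n : ℕ) : ch n = if n % 2 = 0 then 0 else if n % 4 = 1 then 1 else -1 := by
  unfold ch; rw [ZMod.χ₄_nat_eq_if_mod_four]; split_ifs <;> simp

lemma ch_mul (a b : ℕ) : ch (a * b) = ch a * ch b := by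
  unfold ch; rw [Nat.cast_mul, map_mul, Int.cast_mul]

lemma ch_abs (n : ℕ) : |ch n| ≤ 1 := by rw [ch_eq]; split_ifs <;> simp

noncomputable def chS (n : ℕ) : ℝ := ∑ k ∈ Ioc 0 n, ch k

lemma chS_succ (n : ℕ) : chS (n + 1) = chS n + ch (n + 1) := by
  unfold chS; rw [sum_Ioc_succ_top (by omega)]

lemma chS_eq (n : ℕ) : chS n = if n % 4 = 1 ∨ n % 4 = 2 then 1 else 0 := by
  induction n with
  | zero => simp [chS]
  | succ n ih =>
    rw [chS_succ, ih, ch_eq]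
    have : n % 4 < 4 := Nat.mod_lt _ (by norm_num)
    have h : n % 4 = 0 ∨ n % 4 = 1 ∨ n % 4 = 2 ∨ n % 4 = 3 := by omega
    rcases h with h | h | h | h
    · simp [h, show (n+1) % 4 = 1 by omega, show (n+1) % 2 = 1 by omega]
    · simp [h, show (n+1) % 4 = 2 by omega, show (n+1) % 2 = 0 by omega]
    · simp [h, show (n+1) % 4 = 3 by omega, show (n+1) % 2 = 1 by omega]
    · simp [h, show (n+1) % 4 = 0 by omega, show (n+1) % 2 = 0 by omega]

lemma chS_abs (n : ℕ) : |chS n| ≤ 1 := by rw [chS_eq]; split_ifs <;> simp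

lemma ch_bound (g : ℕ → ℝ) (M : ℕ)
    (hg0 : ∀ k, 0 ≤ g k) (hg : ∀ k, M ≤ k → g (k + 1) ≤ g k) (N : ℕ) (hN : M ≤ N) :
    |∑ k ∈ Ioc M N, ch k * g k| ≤ 2 * g M := by
  have := dirichlet_bound chS g 1 M chS_abs hg0 hg N hN
  rw [mul_one] at this
  convert this using 4 with k hk
  have : 0 < k := by have := (mem_Ioc.1 hk).1; omega
  obtain ⟨j, rfl⟩ := Nat.exists_eq_add_of_le' this
  rw [chS_succ, Nat.add_sub_cancel]; ring

noncomputable def L1 (n : ℕ) : ℝ := ∑ k ∈ Ioc 0 n, ch k / k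

lemma L1_two_mul (k : ℕ) : L1 (2 * k) = ∑ i ∈ range k, (-1 : ℝ) ^ i / (2 * i + 1) := by
  induction k with
  | zero => simp [L1]
  | succ k ih =>
    rw [sum_range_succ, ← ih]
    unfold L1
    rw [show 2 * (k + 1) = 2 * k + 1 + 1 by ring, sum_Ioc_succ_top (by omega),
      sum_Ioc_succ_top (by omega)]
    have h1 : ch (2 * k + 1 + 1) = 0 := by rw [ch_eq, if_pos (by omega)]
    have h2 : ch (2 * k + 1) = (-1) ^ k := by
      unfold ch; rw [ZMod.χ₄_eq_neg_one_pow (by omega)]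
      rw [show (2 * k + 1) / 2 = k by omega]; simp
    rw [h1, h2]; push_cast; ring

lemma L1_diff (M N : ℕ) (hM : 0 < M) (hN : M ≤ N) : |L1 N - L1 M| ≤ 2 / M := by
  have h := ch_bound (fun k => 1 / (k : ℝ)) M (fun k => by positivity) (fun k hk => by
    have : (0 : ℝ) < k := by exact_mod_cast (by omega : 0 < k)
    push_cast
    gcongr
    linarith) N hN
  have e : L1 N - L1 M = ∑ k ∈ Ioc M N, ch k * (1 / (k : ℝ)) := by
    unfold L1
    rw [← sum_Ioc_consecutive _ (Nat.zero_le M) hN]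
    simp [div_eq_mul_inv]
  rw [e]; convert h using 1; ring

lemma L1_lim (M : ℕ) (hM : 0 < M) : |Real.pi / 4 - L1 M| ≤ 2 / M := by
  have h := Real.tendsto_sum_pi_div_four
  have h2 := (h.sub_const (L1 M)).abs
  refine le_of_tendsto h2 ?_
  filter_upwards [Filter.eventually_ge_atTop M] with k hk
  rw [← L1_two_mul]
  exact L1_diff M _ hM (by omega)

lemma log_bound : ∃ C : ℝ, ∀ N : ℕ, |∑ k ∈ Ioc 0 N, ch k / k * Real.log k| ≤ C := by
  refine ⟨∑ k ∈ Ioc 0 3, |ch k / k * Real.log k| + 2 * (Real.log 3 / 3), fun N => ?_⟩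
  have hlog : 0 ≤ Real.log 3 / 3 := by positivity
  rcases le_total N 3 with h | h
  · refine (abs_sum_le_sum_abs _ _).trans ?_
    have : ∑ k ∈ Ioc 0 N, |ch k / k * Real.log k| ≤ ∑ k ∈ Ioc 0 3, |ch k / k * Real.log k| :=
      sum_le_sum_of_subset_of_nonneg (Ioc_subset_Ioc_right h) (fun _ _ _ => abs_nonneg _)
    linarith
  · rw [← sum_Ioc_consecutive _ (Nat.zero_le 3) h]
    refine (abs_add_le _ _).trans (add_le_add (abs_sum_le_sum_abs _ _) ?_)
    have := ch_bound (fun k => Real.log k / k) 3 (fun k => by positivity) (fun k hk => by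
      have h3 : (3 : ℝ) ≤ k := by exact_mod_cast hk
      have he := Real.exp_one_lt_d9
      exact Real.log_div_self_antitoneOn (by simp; linarith) (by simp; linarith) (by simp)) N h
    refine le_trans (le_of_eq ?_) (this.trans (le_of_eq (by norm_num)))
    congr 1
    exact sum_congr rfl fun k _ => by ring

noncomputable def fΛ : ArithmeticFunction ℝ := ⟨fun n => ch n / n * vonMangoldt n, by simp⟩
noncomputable def fch : ArithmeticFunction ℝ := ⟨fun n => ch n / n, by simp⟩

lemma conv_eq (n : ℕ) : (fΛ * fch) n = ch n / n * Real.log n := by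
  rcases Nat.eq_zero_or_pos n with rfl | hn
  · simp
  rw [ArithmeticFunction.mul_apply, ← vonMangoldt_sum, mul_sum,
    Nat.sum_divisorsAntidiagonal (fun i j => fΛ i * fch j)]
  refine sum_congr rfl fun d hd => ?_
  obtain ⟨e, rfl⟩ := Nat.dvd_of_mem_divisors hd
  have hd0 : 0 < d := Nat.pos_of_ne_zero (by rintro rfl; simp at hn)
  rw [Nat.mul_div_cancel_left _ hd0]
  simp only [fΛ, fch, ArithmeticFunction.coe_mk, ch_mul]
  push_cast
  rw [mul_div_mul_comm]; ring

lemma psi_nat (N : ℕ) : ∑ d ∈ Ioc 0 N, vonMangoldt d ≤ (Real.log 4 + 4) * N := by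
  have := Chebyshev.psi_le_const_mul_self (x := N) (by positivity)
  simpa [Chebyshev.psi] using this

lemma chΛ_bound : ∃ C : ℝ, ∀ N : ℕ, |∑ d ∈ Ioc 0 N, ch d / d * vonMangoldt d| ≤ C := by
  obtain ⟨C, hC⟩ := log_bound
  refine ⟨(C + 4 * (Real.log 4 + 4)) / (Real.pi / 4), fun N => ?_⟩
  rw [le_div_iff₀ (by positivity)]
  rcases Nat.eq_zero_or_pos N with rfl | hN
  · have := hC 0
    have := Real.log_nonneg (show (1:ℝ) ≤ 4 by norm_num)
    simp at *; linarith
  have hN' : (0 : ℝ) < N := by exact_mod_cast hN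
  have h1 : ∑ k ∈ Ioc 0 N, ch k / k * Real.log k =
      ∑ d ∈ Ioc 0 N, ch d / d * vonMangoldt d * L1 (N / d) := by
    simp_rw [← conv_eq]
    rw [sum_Ioc_mul_eq_sum_sum]
    rfl
  have h2 : |∑ d ∈ Ioc 0 N, ch d / d * vonMangoldt d * (Real.pi / 4 - L1 (N / d))| ≤
      4 * (Real.log 4 + 4) := by
    calc _ ≤ ∑ d ∈ Ioc 0 N, |ch d / d * vonMangoldt d * (Real.pi / 4 - L1 (N / d))| :=
            abs_sum_le_sum_abs _ _
      _ ≤ ∑ d ∈ Ioc 0 N, 4 / N * vonMangoldt d := by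
        refine sum_le_sum fun d hd => ?_
        obtain ⟨hd0, hdN⟩ := mem_Ioc.1 hd
        have hq : 0 < N / d := Nat.div_pos hdN hd0
        have hd' : (0 : ℝ) < d := by exact_mod_cast hd0
        have hq' : (0 : ℝ) < (N / d : ℕ) := by exact_mod_cast hq
        have hΛ : 0 ≤ vonMangoldt d := vonMangoldt_nonneg
        have hlt : (N : ℝ) ≤ 2 * d * (N / d : ℕ) := by
          have h := Nat.div_add_mod N d
          have h' := Nat.mod_lt N hd0
          have : N ≤ 2 * d * (N / d) := by nlinarith
          exact_mod_cast this
        have e1 := L1_lim _ hq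
        have e2 : (2 : ℝ) / (N / d : ℕ) ≤ 4 * d / N := by
          rw [div_le_div_iff₀ hq' hN']; nlinarith
        rw [abs_mul, abs_mul, abs_div, abs_of_nonneg hΛ, abs_of_pos hd']
        have e3 : |ch d| / d ≤ 1 / d := by gcongr; exact ch_abs d
        calc _ ≤ 1 / d * vonMangoldt d * (4 * d / N) := by
              gcongr; exact e1.trans e2
          _ = _ := by field_simp
      _ ≤ _ := by
        rw [← mul_sum]
        have := psi_nat N
        calc _ ≤ 4 / N * ((Real.log 4 + 4) * N) := by gcongr
          _ = _ := by field_simp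
  have h3 := hC N
  rw [h1] at h3
  have h4 : (∑ d ∈ Ioc 0 N, ch d / d * vonMangoldt d) * (Real.pi / 4) =
      ∑ d ∈ Ioc 0 N, ch d / d * vonMangoldt d * L1 (N / d) +
      ∑ d ∈ Ioc 0 N, ch d / d * vonMangoldt d * (Real.pi / 4 - L1 (N / d)) := by
    rw [sum_mul, ← sum_add_distrib]; exact sum_congr rfl fun _ _ => by ring
  rw [← abs_of_pos (show 0 < Real.pi / 4 by positivity), ← abs_mul, h4]
  exact (abs_add_le _ _).trans (add_le_add h3 h2)

lemma sum_log (N : ℕ) : ∑ k ∈ Ioc 0 N, Real.log k ≤ N * Real.log N ∧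
    N * Real.log N - N ≤ ∑ k ∈ Ioc 0 N, Real.log k := by
  induction N with
  | zero => simp
  | succ n ih =>
    rw [sum_Ioc_succ_top (by omega)]
    rcases Nat.eq_zero_or_pos n with rfl | hn
    · simp
    have hn' : (0 : ℝ) < n := by exact_mod_cast hn
    have h1 : Real.log n ≤ Real.log (n + 1) := Real.log_le_log hn' (by linarith)
    have h2 : n * (Real.log (n + 1) - Real.log n) ≤ 1 := by
      rw [← Real.log_div (by positivity) (by positivity)]
      have := Real.log_le_sub_one_of_pos (show 0 < ((n : ℝ) + 1) / n by positivity)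
      calc _ ≤ n * (((n : ℝ) + 1) / n - 1) := by gcongr
        _ = 1 := by field_simp; ring
    push_cast
    constructor <;> nlinarith [ih.1, ih.2]

lemma mertens1 : ∃ C : ℝ, ∀ N : ℕ, 0 < N →
    |∑ d ∈ Ioc 0 N, vonMangoldt d / d - Real.log N| ≤ C := by
  refine ⟨Real.log 4 + 4, fun N hN => ?_⟩
  have hN' : (0 : ℝ) < N := by exact_mod_cast hN
  have h1 : ∑ k ∈ Ioc 0 N, Real.log k = ∑ d ∈ Ioc 0 N, vonMangoldt d * (N / d : ℕ) := by
    rw [← sum_Ioc_mul_zeta_eq_sum, vonMangoldt_mul_zeta]; rfl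
  obtain ⟨h2, h3⟩ := sum_log N
  have h4 := psi_nat N
  have h5 : N * ∑ d ∈ Ioc 0 N, vonMangoldt d / d ≤
      ∑ k ∈ Ioc 0 N, Real.log k + ∑ d ∈ Ioc 0 N, vonMangoldt d := by
    rw [h1, ← sum_add_distrib, mul_sum]
    refine sum_le_sum fun d hd => ?_
    have hΛ : 0 ≤ vonMangoldt d := vonMangoldt_nonneg
    have := Nat.lt_floor_add_one ((N : ℝ) / d)
    rw [Nat.floor_div_eq_div] at this
    calc _ = vonMangoldt d * ((N : ℝ) / d) := by ring
      _ ≤ vonMangoldt d * ((N / d : ℕ) + 1) := by gcongr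
      _ = _ := by ring
  have h6 : ∑ k ∈ Ioc 0 N, Real.log k ≤ N * ∑ d ∈ Ioc 0 N, vonMangoldt d / d := by
    rw [h1, mul_sum]
    refine sum_le_sum fun d hd => ?_
    have hΛ : 0 ≤ vonMangoldt d := vonMangoldt_nonneg
    calc _ ≤ vonMangoldt d * ((N : ℝ) / d) := by gcongr; exact Nat.cast_div_le
      _ = _ := by ring
  have hl : 0 ≤ Real.log 4 := by positivity
  rw [abs_le]
  constructor
  · by_contra hh
    push Not at hh
    have := mul_lt_mul_of_pos_left hh hN'
    nlinarith
  · by_contra hh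
    push Not at hh
    have := mul_lt_mul_of_pos_left hh hN'
    nlinarith

lemma nonprime_bound : ∃ C : ℝ, ∀ N : ℕ,
    ∑ d ∈ Ioc 0 N, (if d.Prime then 0 else vonMangoldt d) / d ≤ C := by
  have h := vonMangoldt.summable_residueClass_non_primes_div (q := 1) (0 : ZMod 1)
  refine ⟨∑' n : ℕ, (if n.Prime then 0 else vonMangoldt.residueClass (0 : ZMod 1) n) / n,
    fun N => ?_⟩
  · have := h.sum_le_tsum (Ioc 0 N) (fun n _ => by
      split_ifs
      · simp
      · exact div_nonneg (vonMangoldt.residueClass_nonneg _ n) (by positivity))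
    refine le_trans (le_of_eq ?_) this
    refine sum_congr rfl fun d _ => ?_
    simp [vonMangoldt.residueClass, Subsingleton.elim ((d : ZMod 1)) 0]

/-- The weight of primes. -/
noncomputable def w (k : ℕ) : ℝ := if k.Prime then (1 + ch k) / k else 0

lemma wlog_bound : ∃ C : ℝ, ∀ N : ℕ, 0 < N →
    |∑ d ∈ Ioc 0 N, w d * Real.log d - Real.log N| ≤ C := by
  obtain ⟨C1, h1⟩ := chΛ_bound
  obtain ⟨C2, h2⟩ := mertens1
  obtain ⟨C3, h3⟩ := nonprime_bound
  refine ⟨C1 + C2 + 2 * C3, fun N hN => ?_⟩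
  have e : ∑ d ∈ Ioc 0 N, w d * Real.log d - Real.log N =
      ∑ d ∈ Ioc 0 N, ch d / d * vonMangoldt d + (∑ d ∈ Ioc 0 N, vonMangoldt d / d - Real.log N)
      - ∑ d ∈ Ioc 0 N, (1 + ch d) * ((if d.Prime then 0 else vonMangoldt d) / d) := by
    have : ∑ d ∈ Ioc 0 N, w d * Real.log d = ∑ d ∈ Ioc 0 N, ch d / d * vonMangoldt d +
      ∑ d ∈ Ioc 0 N, vonMangoldt d / d -
      ∑ d ∈ Ioc 0 N, (1 + ch d) * ((if d.Prime then 0 else vonMangoldt d) / d) := by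
      rw [← sum_add_distrib, ← sum_sub_distrib]
      refine sum_congr rfl fun d _ => ?_
      unfold w
      split_ifs with hp
      · rw [vonMangoldt_apply_prime hp]; ring
      · ring
    rw [this]; ring
  have h4 : |∑ d ∈ Ioc 0 N, (1 + ch d) * ((if d.Prime then 0 else vonMangoldt d) / d)| ≤
      2 * C3 := by
    refine (abs_sum_le_sum_abs _ _).trans ?_
    refine le_trans ?_ (mul_le_mul_of_nonneg_left (h3 N) (by norm_num))
    rw [mul_sum]
    refine sum_le_sum fun d _ => ?_
    have h0 : 0 ≤ (if d.Prime then 0 else vonMangoldt d) / (d : ℝ) := by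
      split_ifs
      · simp
      · exact div_nonneg vonMangoldt_nonneg (by positivity)
    rw [abs_mul, abs_of_nonneg h0]
    gcongr
    have := ch_abs d
    rw [abs_le] at *
    constructor <;> linarith
  rw [e]
  have a := h1 N
  have b := h2 N hN
  rw [abs_le] at *
  constructor <;> linarith

lemma loglog (N : ℕ) (hN : 2 ≤ N) :
    |∑ k ∈ Ioc 2 N, (Real.log k - Real.log (k - 1 : ℕ)) * (1 / Real.log k)
      - (Real.log (Real.log N) - Real.log (Real.log 2))| ≤ 
      Real.log 2 * (1 / Real.log 2 - 1 / Real.log N) := by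
  induction N, hN using Nat.le_induction with
  | base => simp
  | succ n hn ih =>
    rw [sum_Ioc_succ_top (by omega), Nat.add_sub_cancel]
    have hn' : (2 : ℝ) ≤ n := by exact_mod_cast hn
    set v := Real.log n
    set u := Real.log (n + 1 : ℕ) with hu
    have hv : 0 < v := Real.log_pos (by linarith)
    have huv : v ≤ u := Real.log_le_log (by linarith) (by push_cast; linarith)
    have hu0 : 0 < u := by linarith
    have hd : u - v ≤ Real.log 2 := by
      rw [hu, ← Real.log_div (by positivity) (by positivity)]
      apply Real.log_le_log (by positivity)
      rw [div_le_iff₀ (by linarith)]; push_cast; linarith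
    have a1 : Real.log u - Real.log v ≤ u / v - 1 := by
      rw [← Real.log_div hu0.ne' hv.ne']
      exact Real.log_le_sub_one_of_pos (by positivity)
    have a2 : 1 - v / u ≤ Real.log u - Real.log v := by
      have := Real.log_le_sub_one_of_pos (show 0 < v / u by positivity)
      rw [Real.log_div hv.ne' hu0.ne'] at this
      linarith
    have a3 : (u - v) * (1 / u) = 1 - v / u := by field_simp
    have a4 : u / v - 1 - (1 - v / u) = (u - v) * (1 / v - 1 / u) := by field_simp
    have a5 : 0 ≤ 1 / v - 1 / u := by
      have : 1 / u ≤ 1 / v := by gcongr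
      linarith
    have a6 : (u - v) * (1 / v - 1 / u) ≤ Real.log 2 * (1 / v - 1 / u) := by gcongr
    rw [a3]
    rw [abs_le] at *
    constructor <;> linarith

lemma w_bound : ∃ C : ℝ, ∀ N : ℕ, 2 ≤ N →
    |∑ d ∈ Ioc 0 N, w d - Real.log (Real.log N)| ≤ C := by
  obtain ⟨C, hC⟩ := wlog_bound
  set A : ℕ → ℝ := fun N => ∑ d ∈ Ioc 0 N, w d * Real.log d
  set E : ℕ → ℝ := fun N => A N - Real.log N with hE
  have hEC : ∀ k, |E k| ≤ C := by
    intro k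
    rcases Nat.eq_zero_or_pos k with rfl | hk
    · simpa [E, A] using (abs_nonneg _).trans (hC 1 (by norm_num))
    · exact hC k hk
  refine ⟨|∑ d ∈ Ioc 0 2, w d| + 2 * C * (1 / Real.log (2 : ℕ)) + 1 + |Real.log (Real.log 2)|,
    fun N hN => ?_⟩
  have hl2 : 0 < Real.log 2 := Real.log_pos (by norm_num)
  have h1 := dirichlet_bound E (fun k => 1 / Real.log k) C 2 hEC (fun k => by positivity)
    (fun k hk => by
      have hk' : (2 : ℝ) ≤ k := by exact_mod_cast hk
      have : 0 < Real.log k := Real.log_pos (by linarith)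
      push_cast
      gcongr
      linarith) N hN
  have h2 := loglog N hN
  have h3 : Real.log 2 * (1 / Real.log 2 - 1 / Real.log N) ≤ 1 := by
    have : Real.log 2 * (1 / Real.log 2) = 1 := by field_simp
    have h : 0 ≤ Real.log 2 * (1 / Real.log N) := by positivity
    linarith
  have e : ∑ d ∈ Ioc 0 N, w d = ∑ d ∈ Ioc 0 2, w d +
      (∑ k ∈ Ioc 2 N, (E k - E (k - 1)) * (1 / Real.log k) +
      ∑ k ∈ Ioc 2 N, (Real.log k - Real.log (k - 1 : ℕ)) * (1 / Real.log k)) := by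
    rw [← sum_Ioc_consecutive _ (Nat.zero_le 2) hN, ← sum_add_distrib]
    congr 1
    refine sum_congr rfl fun k hk => ?_
    obtain ⟨hk0, -⟩ := mem_Ioc.1 hk
    obtain ⟨j, rfl⟩ := Nat.exists_eq_add_of_le' (show 1 ≤ k by omega)
    have hl : Real.log ((j + 1 : ℕ) : ℝ) ≠ 0 :=
      (Real.log_pos (by exact_mod_cast (show 1 < j + 1 by omega))).ne'
    have hA : A (j + 1) = A j + w (j + 1) * Real.log (j + 1 : ℕ) := by
      simp only [A]; rw [sum_Ioc_succ_top (by omega)]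
    rw [Nat.add_sub_cancel]
    simp only [E]
    rw [hA]
    field_simp
    ring
  rw [e]
  have h5 := neg_abs_le (∑ d ∈ Ioc 0 2, w d)
  have h6 := le_abs_self (∑ d ∈ Ioc 0 2, w d)
  have h7 := neg_abs_le (Real.log (Real.log 2))
  have h8 := le_abs_self (Real.log (Real.log 2))
  obtain ⟨h1a, h1b⟩ := abs_le.1 h1
  obtain ⟨h2a, h2b⟩ := abs_le.1 h2
  rw [abs_le]
  constructor <;> linarith

/-- Nonzero prime ideals of norm `k`. -/
def P (k : ℕ) : Set (Ideal GaussianInt) :=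
  {𝔭 | 𝔭 ≠ ⊥ ∧ 𝔭.IsPrime ∧ Nat.card (GaussianInt ⧸ 𝔭) = k}

lemma structure_prime (𝔭 : Ideal GaussianInt) (h0 : 𝔭 ≠ ⊥) (hp : 𝔭.IsPrime) :
    ∃ p : ℕ, p.Prime ∧ (Nat.card (GaussianInt ⧸ 𝔭) = p ∨
      (Nat.card (GaussianInt ⧸ 𝔭) = p ^ 2 ∧ 𝔭 = Ideal.span {(p : GaussianInt)})) := by
  obtain ⟨z, hz, hz0⟩ := Submodule.exists_mem_ne_zero_of_ne_bot h0
  have hn : ((z.norm : ℤ) : GaussianInt) ∈ 𝔭 := by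
    rw [Zsqrtd.norm_eq_mul_conj]; exact 𝔭.mul_mem_right _ hz
  have hn0 : z.norm ≠ 0 := fun h => hz0 (GaussianInt.norm_eq_zero.1 h)
  obtain ⟨p, hchar⟩ := CharP.exists (GaussianInt ⧸ 𝔭)
  have hcast : ((z.norm : ℤ) : GaussianInt ⧸ 𝔭) = 0 := by
    have := Ideal.Quotient.eq_zero_iff_mem.2 hn
    simpa using this
  have hpp : p.Prime := by
    rcases CharP.char_is_prime_or_zero (GaussianInt ⧸ 𝔭) p with h | h
    · exact h
    · subst h
      rw [CharP.intCast_eq_zero_iff (GaussianInt ⧸ 𝔭) 0] at hcast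
      exact absurd (by simpa using hcast) hn0
  have : Fact p.Prime := ⟨hpp⟩
  refine ⟨p, hpp, ?_⟩
  let c : ZMod p →+* GaussianInt ⧸ 𝔭 := ZMod.castHom dvd_rfl _
  let I : GaussianInt ⧸ 𝔭 := Ideal.Quotient.mk 𝔭 ⟨0, 1⟩
  let f : ZMod p × ZMod p →+ GaussianInt ⧸ 𝔭 :=
    { toFun := fun x => c x.1 + c x.2 * I
      map_zero' := by simp
      map_add' := fun x y => by simp only [Prod.fst_add, Prod.snd_add, map_add]; ring }
  have hf : ∀ z : GaussianInt, f ((z.re : ZMod p), (z.im : ZMod p)) = Ideal.Quotient.mk 𝔭 z := by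
    intro z
    have : z = (z.re : GaussianInt) + (z.im : GaussianInt) * ⟨0, 1⟩ := by
      ext <;> simp
    conv_rhs => rw [this, map_add, map_mul, map_intCast, map_intCast]
    simp only [f, I, AddMonoidHom.coe_mk, ZeroHom.coe_mk, map_intCast]
  have hsurj : Function.Surjective f := by
    intro y
    obtain ⟨z, rfl⟩ := Ideal.Quotient.mk_surjective y
    exact ⟨_, hf z⟩
  have hfin : Finite (GaussianInt ⧸ 𝔭) := Finite.of_surjective f hsurj
  have hcard : Nat.card (ZMod p × ZMod p) = p ^ 2 := by simp [sq]
  have hdvd : Nat.card (GaussianInt ⧸ 𝔭) ∣ p ^ 2 := by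
    rw [← hcard]; exact AddSubgroup.card_dvd_of_surjective f hsurj
  obtain ⟨j, hj, hjc⟩ := (Nat.dvd_prime_pow hpp).1 hdvd
  have h1 : 1 < Nat.card (GaussianInt ⧸ 𝔭) := Finite.one_lt_card
  have hj' : j = 0 ∨ j = 1 ∨ j = 2 := by omega
  rcases hj' with rfl | rfl | rfl
  · simp [hjc] at h1
  · left; simpa using hjc
  · right
    refine ⟨hjc, ?_⟩
    have hbij : Function.Bijective f := by
      rw [Nat.bijective_iff_surjective_and_card]
      exact ⟨hsurj, by rw [hcard, hjc]⟩
    apply le_antisymm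
    · intro z hz
      have h := hf z
      rw [Ideal.Quotient.eq_zero_iff_mem.2 hz] at h
      have h' := hbij.1 (h.trans (map_zero f).symm)
      simp only [Prod.mk_eq_zero, ZMod.intCast_zmod_eq_zero_iff_dvd] at h'
      rw [Ideal.mem_span_singleton]
      have := (Zsqrtd.intCast_dvd (d := -1) (p : ℤ) z).2 h'
      simpa using this
    · rw [Ideal.span_singleton_le_iff_mem, ← Ideal.Quotient.eq_zero_iff_mem]
      simp

lemma zmod_two_one : (1 : ZMod 2) * 1 = ((-1 : ℤ) : ZMod 2) := by decide

lemma zmod_two_key : ∀ a b : ZMod 2, a * a = ((-1 : ℤ) : ZMod 2) →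
    b * b = ((-1 : ℤ) : ZMod 2) → a = b := by decide

lemma P_prime (p : ℕ) [hp : Fact p.Prime] :
    (P p).Finite ∧ ((P p).ncard : ℝ) = 1 + ch p := by
  let Φ : {r : ZMod p // r * r = ((-1 : ℤ) : ZMod p)} → Ideal GaussianInt :=
    fun r => RingHom.ker (Zsqrtd.lift r)
  have hsurj : ∀ r : {r : ZMod p // r * r = ((-1 : ℤ) : ZMod p)},
      Function.Surjective (Zsqrtd.lift r) := by
    intro r y
    obtain ⟨k, rfl⟩ := ZMod.intCast_surjective y
    exact ⟨k, by simp⟩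
  have hinj : Function.Injective Φ := by
    intro r s h
    obtain ⟨k, hk⟩ := ZMod.intCast_surjective r.1
    have h1 : (⟨-k, 1⟩ : GaussianInt) ∈ Φ r := by
      simp [Φ, RingHom.mem_ker, hk]
    rw [h] at h1
    have h2 : -(k : ZMod p) + s.1 = 0 := by
      simpa [Φ, RingHom.mem_ker] using h1
    apply Subtype.ext
    rw [← hk]
    linear_combination -h2
  have hrange : P p = Set.range Φ := by
    ext 𝔭
    constructor
    · rintro ⟨h0, h1, h2⟩
      have hfin : Finite (GaussianInt ⧸ 𝔭) :=
        Nat.finite_of_card_ne_zero (by rw [h2]; exact hp.1.ne_zero)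
      have := Fintype.ofFinite (GaussianInt ⧸ 𝔭)
      rw [Nat.card_eq_fintype_card] at h2
      let e := ZMod.ringEquivOfPrime (GaussianInt ⧸ 𝔭) hp.1 h2
      let φ : GaussianInt →+* ZMod p := (e.symm : _ →+* ZMod p).comp (Ideal.Quotient.mk 𝔭)
      refine ⟨Zsqrtd.lift.symm φ, ?_⟩
      simp only [Φ, Equiv.apply_symm_apply]
      ext z
      simp [RingHom.mem_ker, φ, Ideal.Quotient.eq_zero_iff_mem]
    · rintro ⟨r, rfl⟩
      refine ⟨?_, RingHom.ker_isPrime _, ?_⟩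
      · intro h
        have : (p : GaussianInt) ∈ Φ r := by simp [Φ, RingHom.mem_ker]
        rw [h, Ideal.mem_bot] at this
        exact hp.1.ne_zero (by exact_mod_cast this)
      · rw [Nat.card_congr (RingHom.quotientKerEquivOfSurjective (hsurj r)).toEquiv]
        simp
  refine ⟨hrange ▸ Set.finite_range _, ?_⟩
  rw [hrange, ← Nat.card_coe_set_eq, Nat.card_range_of_injective hinj]
  rcases hp.1.eq_two_or_odd with h2 | hodd
  · subst h2
    have : ch 2 = 0 := by
      unfold ch; rw [ZMod.χ₄_nat_eq_if_mod_four]; simp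
    rw [this]
    have : Nat.card {r : ZMod 2 // r * r = ((-1 : ℤ) : ZMod 2)} = 1 := by
      rw [Nat.card_eq_one_iff_unique]
      refine ⟨⟨?_⟩, ⟨⟨1, zmod_two_one⟩⟩⟩
      rintro ⟨a, ha⟩ ⟨b, hb⟩
      exact Subtype.ext (zmod_two_key a b ha hb)
    rw [this]; simp
  · have hp2 : p ≠ 2 := by rintro rfl; simp at hodd
    have h := legendreSym.card_sqrts p hp2 (-1)
    rw [legendreSym.at_neg_one hp2] at h
    have e : Nat.card {r : ZMod p // r * r = ((-1 : ℤ) : ZMod p)} =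
        {x : ZMod p | x ^ 2 = ((-1 : ℤ) : ZMod p)}.toFinset.card := by
      rw [Set.toFinset_card, ← Nat.card_eq_fintype_card]
      simp only [sq]; rfl
    rw [e]
    have h' : (({x : ZMod p | x ^ 2 = ((-1 : ℤ) : ZMod p)}.toFinset.card : ℤ) : ℝ) =
      ((ZMod.χ₄ p + 1 : ℤ) : ℝ) := by rw [h]
    unfold ch
    push_cast at h' ⊢
    rw [h']; ring

lemma P_nonprime (k : ℕ) (hk : ¬ k.Prime) : (P k).Finite ∧ (P k).ncard ≤ 1 ∧
    ((P k).ncard ≠ 0 → ∃ p : ℕ, 0 < p ∧ k = p ^ 2) := by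
  have h : ∀ 𝔭 ∈ P k, ∃ p : ℕ, 0 < p ∧ k = p ^ 2 ∧ 𝔭 = Ideal.span {(p : GaussianInt)} := by
    rintro 𝔭 ⟨h0, h1, h2⟩
    obtain ⟨p, hp, h | ⟨h, h'⟩⟩ := structure_prime 𝔭 h0 h1
    · exact absurd (h2 ▸ h ▸ hp) hk
    · exact ⟨p, hp.pos, by rw [← h2, h], h'⟩
  have hs : (P k).Subsingleton := by
    intro a ha b hb
    obtain ⟨p, _, h1, rfl⟩ := h a ha
    obtain ⟨q, _, h2, rfl⟩ := h b hb
    have : p = q := Nat.pow_left_injective (n := 2) (by norm_num) (h1.symm.trans h2)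
    rw [this]
  refine ⟨hs.finite, ?_, ?_⟩
  · have := hs.finite.to_subtype
    exact Set.ncard_le_one_iff_subsingleton.2 hs
  · intro hne
    obtain ⟨a, ha⟩ := Set.nonempty_of_ncard_ne_zero hne
    obtain ⟨p, h0, h1, -⟩ := h a ha
    exact ⟨p, h0, h1⟩

lemma P_finite (k : ℕ) : (P k).Finite := by
  by_cases hk : k.Prime
  · have := Fact.mk hk
    exact (P_prime k).1
  · exact (P_nonprime k hk).1

lemma sum_eq (n : ℝ) (hn : 0 ≤ n) :
    (∑ᶠ 𝔭 ∈ {𝔭 : Ideal GaussianInt | 𝔭 ≠ ⊥ ∧ 𝔭.IsPrime ∧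
        (Nat.card (GaussianInt ⧸ 𝔭) : ℝ) ≤ n},
          (1 : ℝ) / (Nat.card (GaussianInt ⧸ 𝔭) : ℝ)) =
    ∑ k ∈ Ioc 0 ⌊n⌋₊, ((P k).ncard : ℝ) / k := by
  have hset : {𝔭 : Ideal GaussianInt | 𝔭 ≠ ⊥ ∧ 𝔭.IsPrime ∧
        (Nat.card (GaussianInt ⧸ 𝔭) : ℝ) ≤ n} = ⋃ k ∈ (↑(Ioc 0 ⌊n⌋₊) : Set ℕ), P k := by
    ext 𝔭
    simp only [Set.mem_ofPred_eq, Set.mem_iUnion, P, mem_coe, mem_Ioc, exists_prop]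
    constructor
    · rintro ⟨h0, h1, h2⟩
      refine ⟨_, ⟨?_, Nat.le_floor h2⟩, h0, h1, rfl⟩
      obtain ⟨p, hp, h | ⟨h, -⟩⟩ := structure_prime 𝔭 h0 h1
      · rw [h]; exact hp.pos
      · rw [h]; exact pow_pos hp.pos 2
    · rintro ⟨k, ⟨_, hk⟩, h0, h1, rfl⟩
      exact ⟨h0, h1, (Nat.le_floor_iff hn).1 hk⟩
  rw [hset, finsum_mem_biUnion _ (Finset.finite_toSet _) (fun k _ => P_finite k),
    finsum_mem_coe_finset]
  · refine sum_congr rfl fun k _ => ?_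
    rw [finsum_mem_congr rfl (g := fun _ => (1 : ℝ) / k) (fun 𝔭 h𝔭 => by rw [h𝔭.2.2]),
      finsum_mem_eq_finite_toFinset_sum _ (P_finite k), sum_const,
      Set.ncard_eq_toFinset_card _ (P_finite k), nsmul_eq_mul]
    ring
  · intro a _ b _ hab
    refine Set.disjoint_left.2 fun 𝔭 ha hb => hab ?_
    rw [← ha.2.2, hb.2.2]

lemma sq_sum (N : ℕ) : ∑ p ∈ Ioc 0 N, (1 : ℝ) / ((p ^ 2 : ℕ) : ℝ) ≤
    ∑' p : ℕ, (1 : ℝ) / (p : ℝ) ^ 2 := by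
  have h : Summable fun p : ℕ => (1 : ℝ) / (p : ℝ) ^ 2 :=
    Real.summable_one_div_nat_pow.2 (by norm_num)
  have := h.sum_le_tsum (Ioc 0 N) (fun _ _ => by positivity)
  simpa using this

lemma diff_bound (N : ℕ) : |∑ k ∈ Ioc 0 N, ((P k).ncard : ℝ) / k - ∑ k ∈ Ioc 0 N, w k| ≤
    ∑' p : ℕ, (1 : ℝ) / (p : ℝ) ^ 2 := by
  have hterm : ∀ k, ((P k).ncard : ℝ) / k - w k =
      if k.Prime then 0 else ((P k).ncard : ℝ) / k := by
    intro k
    unfold w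
    split_ifs with hk
    · have := Fact.mk hk
      rw [(P_prime k).2]; ring
    · ring
  rw [← sum_sub_distrib]
  simp_rw [hterm]
  rw [abs_of_nonneg (sum_nonneg fun k _ => by split_ifs <;> positivity)]
  refine le_trans ?_ (sq_sum N)
  have hinj : Set.InjOn (fun p : ℕ => p ^ 2) (Ioc 0 N : Finset ℕ) :=
    fun a _ b _ h => Nat.pow_left_injective (n := 2) (by norm_num) h
  rw [← sum_image (f := fun k : ℕ => (1 : ℝ) / (k : ℝ)) hinj]
  have h1 : ∀ k ∈ Ioc 0 N, (if k.Prime then 0 else ((P k).ncard : ℝ) / k) ≠ 0 →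
      k ∈ (Ioc 0 N).image (fun p : ℕ => p ^ 2) := by
    intro k hk hne
    split_ifs at hne with hp
    · exact absurd rfl hne
    · have : (P k).ncard ≠ 0 := by rintro h; simp [h] at hne
      obtain ⟨p, h0, rfl⟩ := (P_nonprime k hp).2.2 this
      refine mem_image.2 ⟨p, mem_Ioc.2 ⟨h0, ?_⟩, rfl⟩
      have := (mem_Ioc.1 hk).2
      nlinarith
  rw [← sum_filter_ne_zero]
  calc _ ≤ ∑ k ∈ Ioc 0 N with (if k.Prime then 0 else ((P k).ncard : ℝ) / k) ≠ 0,
          (1 : ℝ) / (k : ℝ) := by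
        refine sum_le_sum fun k _ => ?_
        split_ifs with hp
        · positivity
        · have : ((P k).ncard : ℝ) ≤ 1 := by exact_mod_cast (P_nonprime k hp).2.1
          gcongr
    _ ≤ _ := by
        refine sum_le_sum_of_subset_of_nonneg ?_ (fun _ _ _ => by positivity)
        intro k hk
        rw [mem_filter] at hk
        exact h1 k hk.1 hk.2

lemma loglog_floor (n : ℝ) (hn : 3 ≤ n) :
    |Real.log (Real.log ⌊n⌋₊) - Real.log (Real.log n)| ≤ 1 := by
  have hf : (3 : ℝ) ≤ ⌊n⌋₊ := by exact_mod_cast Nat.le_floor (by exact_mod_cast hn)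
  have h1 : (⌊n⌋₊ : ℝ) ≤ n := Nat.floor_le (by linarith)
  have h2 := Nat.lt_floor_add_one n
  set m : ℝ := (⌊n⌋₊ : ℝ)
  have he : Real.exp 1 < 3 := by have := Real.exp_one_lt_d9; linarith
  have a1 : 1 ≤ Real.log m := by
    rw [Real.le_log_iff_exp_le (by linarith)]; linarith
  have a2 : Real.log m ≤ Real.log n := Real.log_le_log (by linarith) h1
  have a3 : Real.log n ≤ Real.log m + 1 := by
    have : Real.log n - Real.log m ≤ n / m - 1 := by
      rw [← Real.log_div (by linarith) (by linarith)]
      exact Real.log_le_sub_one_of_pos (div_pos (by linarith) (by linarith))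
    have : n / m ≤ 2 := by rw [div_le_iff₀ (by linarith)]; linarith
    linarith
  have a4 : Real.log (Real.log m) ≤ Real.log (Real.log n) := Real.log_le_log (by linarith) a2
  have a5 : Real.log (Real.log n) - Real.log (Real.log m) ≤ 1 := by
    rw [← Real.log_div (by linarith) (by linarith)]
    have := Real.log_le_sub_one_of_pos
      (show 0 < Real.log n / Real.log m from div_pos (by linarith) (by linarith))
    have : Real.log n / Real.log m ≤ 2 := by rw [div_le_iff₀ (by linarith)]; linarith
    linarith
  rw [abs_le]; constructor <;> linarith

end GMert

/-- Mertens-type estimate for the Gaussian integers: there is `C > 0` such that for all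
real `n ≥ 3`, `|∑_{N(𝔭) ≤ n} 1/N(𝔭) − log log n| ≤ C`, the sum ranging over nonzero prime
ideals `𝔭` of `ℤ[i]`, where `N(𝔭) = #(ℤ[i]/𝔭)` is the absolute norm. -/
theorem stmt5 : ∃ C > (0 : ℝ), ∀ n : ℝ, 3 ≤ n →
    |(∑ᶠ 𝔭 ∈ {𝔭 : Ideal GaussianInt | 𝔭 ≠ ⊥ ∧ 𝔭.IsPrime ∧
        (Nat.card (GaussianInt ⧸ 𝔭) : ℝ) ≤ n},
          (1 : ℝ) / (Nat.card (GaussianInt ⧸ 𝔭) : ℝ))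
      - Real.log (Real.log n)| ≤ C := by
  obtain ⟨C, hC⟩ := GMert.w_bound
  refine ⟨C + (∑' p : ℕ, (1 : ℝ) / (p : ℝ) ^ 2) + 1, ?_, fun n hn => ?_⟩
  · have h1 := (abs_nonneg _).trans (hC 2 le_rfl)
    have h2 : 0 ≤ ∑' p : ℕ, (1 : ℝ) / (p : ℝ) ^ 2 := tsum_nonneg fun _ => by positivity
    linarith
  rw [GMert.sum_eq n (by linarith)]
  have h1 := hC ⌊n⌋₊ (Nat.le_floor (by push_cast; linarith))
  have h2 := GMert.diff_bound ⌊n⌋₊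
  have h3 := GMert.loglog_floor n hn
  rw [abs_le] at *
  constructor <;> linarith
end

section
/- Define β on nonzero prime ideals 𝔭 of ℤ[i] by β(𝔭) = (2/N(𝔭))·(1 + 1/(N(𝔭)² − 1)) if N(𝔭) > 2 and β(𝔭) = (1/N(𝔭))·(1 + 1/(N(𝔭)² − 1)) if N(𝔭) = 2, where N(𝔭) is the absolute norm. Then 0 < β(𝔭) < 1 for every nonzero prime ideal 𝔭, and there is a constant C > 0 such that for all real numbers 2 ≤ w < z, ∏_{𝔭 : w ≤ N(𝔭) < z} (1 − β(𝔭))⁻¹ ≤ C·(log z / log w)², the product ranging over nonzero prime ideals 𝔭 of ℤ[i] with w ≤ N(𝔭) < z. -/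
noncomputable def chi (n : ℕ) : ℝ := ((ZMod.χ₄ (n : ZMod 4) : ℤ) : ℝ)

lemma chi_mul (m n : ℕ) : chi (m * n) = chi m * chi n := by
  unfold chi
  rw [Nat.cast_mul, map_mul, Int.cast_mul]

lemma chi_period (n : ℕ) : chi (n + 4) = chi n := by
  unfold chi
  have h4 : (4 : ZMod 4) = 0 := by decide
  rw [Nat.cast_add, Nat.cast_ofNat, h4, add_zero]

lemma chi_abs (n : ℕ) : |chi n| ≤ 1 := by
  unfold chi
  have : ∀ a : ZMod 4, |ZMod.χ₄ a| ≤ 1 := by decide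
  exact_mod_cast this n

lemma chi_zero : chi 0 = 0 := by
  have : ZMod.χ₄ ((0:ℕ) : ZMod 4) = 0 := by decide
  simp [chi]
lemma chi_one : chi 1 = 1 := by
  simp [chi]
lemma chi_two : chi 2 = 0 := by
  have : ZMod.χ₄ ((2:ℕ) : ZMod 4) = 0 := by decide
  simp only [chi, this]; simp
lemma chi_three : chi 3 = -1 := by
  have : ZMod.χ₄ ((3:ℕ) : ZMod 4) = -1 := by decide
  simp only [chi, this]; simp

noncomputable def chiS (N : ℕ) : ℝ := ∑ n ∈ Finset.Ioc 0 N, chi n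

lemma chiS_succ (N : ℕ) : chiS (N + 1) = chiS N + chi (N + 1) := by
  unfold chiS
  rw [Finset.sum_Ioc_succ_top (Nat.zero_le N)]

lemma chiS_vals (k : ℕ) : chiS (4 * k) = 0 ∧ chiS (4 * k + 1) = 1 ∧ chiS (4 * k + 2) = 1 ∧
    chiS (4 * k + 3) = 0 := by
  have hp : ∀ k j : ℕ, chi (4 * k + j) = chi j := by
    intro k j
    induction k with
    | zero => simp
    | succ k ih =>
      rw [show 4 * (k + 1) + j = (4 * k + j) + 4 by ring, chi_period, ih]
  have h0 : ∀ k : ℕ, chiS (4 * k) = 0 → chiS (4 * k) = 0 ∧ chiS (4 * k + 1) = 1 ∧ chiS (4 * k + 2) = 1 ∧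
    chiS (4 * k + 3) = 0 := by
    intro k h
    have h1 : chiS (4 * k + 1) = 1 := by rw [chiS_succ, h, hp, chi_one]; norm_num
    have h2 : chiS (4 * k + 2) = 1 := by
      rw [show 4 * k + 2 = (4 * k + 1) + 1 by ring, chiS_succ, h1, add_assoc, hp, chi_two]
      norm_num
    have h3 : chiS (4 * k + 3) = 0 := by
      rw [show 4 * k + 3 = (4 * k + 2) + 1 by ring, chiS_succ, h2, add_assoc, hp, chi_three]
      norm_num
    exact ⟨h, h1, h2, h3⟩
  apply h0
  induction k with
  | zero => simp [chiS]
  | succ k ih =>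
    have := (h0 k ih).2.2.2
    rw [show 4 * (k + 1) = (4 * k + 3) + 1 by ring, chiS_succ, this, add_assoc, hp,
      show 3 + 1 = 0 + 4 by rfl, chi_period, chi_zero]
    norm_num

lemma chiS_mem (N : ℕ) : 0 ≤ chiS N ∧ chiS N ≤ 1 := by
  obtain ⟨h0, h1, h2, h3⟩ := chiS_vals (N / 4)
  have : N = 4 * (N / 4) ∨ N = 4 * (N / 4) + 1 ∨ N = 4 * (N / 4) + 2 ∨ N = 4 * (N / 4) + 3 := by
    omega
  rcases this with h | h | h | h <;> rw [h]
  · rw [h0]; norm_num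
  · rw [h1]; norm_num
  · rw [h2]; norm_num
  · rw [h3]; norm_num

/-- Quantitative Dirichlet test for `chi`. -/
lemma chi_dirichlet (g : ℕ → ℝ) (k : ℕ) (hg0 : ∀ n, k < n → 0 ≤ g n)
    (hg : ∀ n, k < n → g (n + 1) ≤ g n) (j : ℕ) (hj : k ≤ j) :
    |∑ n ∈ Finset.Ioc k j, chi n * g n| ≤ g (k + 1) := by
  have key : |∑ n ∈ Finset.Ioc k j, chi n * g n - (chiS j - chiS k) * g (j + 1)|
      ≤ g (k + 1) - g (j + 1) := by
    induction j, hj using Nat.le_induction with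
    | base => simp
    | succ j hj ih =>
      rw [Finset.sum_Ioc_succ_top hj]
      have e : ∑ n ∈ Finset.Ioc k j, chi n * g n + chi (j + 1) * g (j + 1)
          - (chiS (j + 1) - chiS k) * g (j + 1 + 1)
          = (∑ n ∈ Finset.Ioc k j, chi n * g n - (chiS j - chiS k) * g (j + 1))
            + (chiS (j + 1) - chiS k) * (g (j + 1) - g (j + 1 + 1)) := by
        rw [chiS_succ]; ring
      rw [e]
      have h1 : |chiS (j + 1) - chiS k| ≤ 1 := by
        have := chiS_mem (j + 1); have := chiS_mem k
        rw [abs_le]; constructor <;> linarith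
      have h2 := hg (j + 1) (by omega)
      have h3 : |(chiS (j + 1) - chiS k) * (g (j + 1) - g (j + 1 + 1))|
          ≤ g (j + 1) - g (j + 1 + 1) := by
        rw [abs_mul, abs_of_nonneg (sub_nonneg.2 h2)]
        exact mul_le_of_le_one_left (sub_nonneg.2 h2) h1
      refine (abs_add_le _ _).trans ?_
      linarith
  have h1 : |(chiS j - chiS k) * g (j + 1)| ≤ g (j + 1) := by
    rw [abs_mul, abs_of_nonneg (hg0 (j + 1) (by omega))]
    refine mul_le_of_le_one_left (hg0 (j + 1) (by omega)) ?_
    have := chiS_mem j; have := chiS_mem k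
    rw [abs_le]; constructor <;> linarith
  have := abs_add_le (∑ n ∈ Finset.Ioc k j, chi n * g n - (chiS j - chiS k) * g (j + 1))
    ((chiS j - chiS k) * g (j + 1))
  rw [sub_add_cancel] at this
  linarith

noncomputable def chiB (N : ℕ) : ℝ := ∑ n ∈ Finset.Ioc 0 N, chi n * (1 / (n : ℝ))

lemma chiB_sub (k j : ℕ) (h : k ≤ j) : |chiB j - chiB k| ≤ 1 / ((k : ℝ) + 1) := by
  have e : chiB j - chiB k = ∑ n ∈ Finset.Ioc k j, chi n * (1 / (n : ℝ)) := by
    unfold chiB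
    rw [← Finset.sum_Ioc_consecutive _ (Nat.zero_le k) h]; ring
  rw [e]
  have := chi_dirichlet (fun n => 1 / (n : ℝ)) k (fun n _ => by positivity) (fun n hn => by
    have : (0 : ℝ) < n := by exact_mod_cast (by omega : 0 < n)
    push_cast
    exact one_div_le_one_div_of_le this (by linarith)) j h
  simpa using this

lemma exists_L : ∃ L : ℝ, 1 / 2 ≤ L ∧ ∀ k : ℕ, |chiB k - L| ≤ 1 / ((k : ℝ) + 1) := by
  have hc : CauchySeq chiB := by
    refine cauchySeq_of_le_tendsto_0 (fun k : ℕ => 2 * (1 / ((k : ℝ) + 1))) ?_ ?_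
    · intro n m N hn hm
      have h1 := chiB_sub N n hn
      have h2 := chiB_sub N m hm
      rw [Real.dist_eq]
      rw [abs_le] at *
      constructor <;> linarith [h1.1, h1.2, h2.1, h2.2]
    · simpa using (tendsto_one_div_add_atTop_nhds_zero_nat (𝕜 := ℝ)).const_mul 2
  obtain ⟨L, hL⟩ := cauchySeq_tendsto_of_complete hc
  have hb : ∀ k : ℕ, |chiB k - L| ≤ 1 / ((k : ℝ) + 1) := by
    intro k
    have ht : Filter.Tendsto (fun j => |chiB j - chiB k|) Filter.atTop (nhds |L - chiB k|) :=
      (hL.sub_const _).abs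
    rw [abs_sub_comm]
    exact le_of_tendsto ht (Filter.eventually_atTop.2 ⟨k, fun j hj => chiB_sub k j hj⟩)
  refine ⟨L, ?_, hb⟩
  have := hb 1
  have e : chiB 1 = 1 := by simp [chiB, chi_one]
  rw [e, abs_le] at this
  norm_num at this
  linarith [this.2]

open ArithmeticFunction in
lemma twisted_conv (N : ℕ) : ∑ n ∈ Finset.Ioc 0 N, chi n * (Real.log n / n)
    = ∑ d ∈ Finset.Ioc 0 N, chi d * vonMangoldt d / d * chiB (N / d) := by
  let f : ArithmeticFunction ℝ := ⟨fun n => chi n * vonMangoldt n / n, by simp⟩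
  let g : ArithmeticFunction ℝ := ⟨fun n => chi n * (1 / (n : ℝ)), by simp⟩
  have h := sum_Ioc_mul_eq_sum_sum f g N
  refine Eq.trans (Finset.sum_congr rfl fun n hn => ?_) h
  have hn0 : n ≠ 0 := by have := (Finset.mem_Ioc.1 hn).1; omega
  rw [ArithmeticFunction.mul_apply]
  have : ∀ x ∈ n.divisorsAntidiagonal, f x.1 * g x.2 = chi n / n * vonMangoldt x.1 := by
    rintro ⟨a, b⟩ hx
    obtain ⟨hab, -⟩ := Nat.mem_divisorsAntidiagonal.1 hx
    simp only at hab
    have : a ≠ 0 := by rintro rfl; simp at hab; exact hn0 hab.symm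
    have : b ≠ 0 := by rintro rfl; simp at hab; exact hn0 hab.symm
    change chi a * vonMangoldt a / a * (chi b * (1 / (b : ℝ))) = _
    rw [← hab, chi_mul]; push_cast; field_simp
  rw [Finset.sum_congr rfl this, ← Finset.mul_sum,
    Nat.sum_divisorsAntidiagonal (fun i _ => vonMangoldt i), vonMangoldt_sum]
  ring

lemma psi_sum_le (N : ℕ) :
    ∑ d ∈ Finset.Ioc 0 N, ArithmeticFunction.vonMangoldt d ≤ (Real.log 4 + 4) * N := by
  have := Chebyshev.psi_le_const_mul_self (x := (N : ℝ)) (by positivity)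
  simpa [Chebyshev.psi] using this

lemma div_succ_bound (N d : ℕ) (hd : 0 < d) (hN : 0 < N) :
    1 / (((N / d : ℕ) : ℝ) + 1) ≤ d / N := by
  have h : N < d * (N / d + 1) := Nat.lt_mul_div_succ N hd
  have h' : (N : ℝ) ≤ d * ((N / d : ℕ) + 1) := by exact_mod_cast h.le
  rw [div_le_div_iff₀ (by positivity) (by positivity)]
  linarith

lemma chi_log_bound (N : ℕ) : |∑ n ∈ Finset.Ioc 0 N, chi n * (Real.log n / n)| ≤ 1 := by
  have h3 : Real.log 3 / 3 ≤ 1 := by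
    have := Real.log_le_sub_one_of_pos (x := 3) (by norm_num)
    linarith
  by_cases hN : N ≤ 2
  · interval_cases N
    · simp
    · simp
    · rw [show Finset.Ioc 0 2 = {1, 2} by rfl]; simp [chi_two]
  · rw [← Finset.sum_Ioc_consecutive _ (Nat.zero_le 2) (by omega : 2 ≤ N),
      show Finset.Ioc 0 2 = {1, 2} by rfl]
    have := chi_dirichlet (fun n => Real.log n / n) 2 (fun n hn => by positivity) (fun n hn => by
      have hn3 : (3 : ℝ) ≤ n := by exact_mod_cast hn
      have := Real.exp_one_lt_d9
      have := Real.log_div_self_antitoneOn (a := (n : ℝ)) (b := (n + 1 : ℝ))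
        (by simp only [Set.mem_Ici]; linarith) (by simp only [Set.mem_Ici]; linarith) (by linarith)
      simpa using this) N (by omega)
    simp only [Finset.sum_pair (show (1 : ℕ) ≠ 2 by norm_num)]
    simp only [chi_two]
    norm_num at this ⊢
    linarith

open ArithmeticFunction in
lemma twisted_mertens : ∃ K : ℝ, ∀ N : ℕ,
    |∑ d ∈ Finset.Ioc 0 N, chi d * vonMangoldt d / d| ≤ K := by
  obtain ⟨L, hL, hB⟩ := exists_L
  refine ⟨2 * (1 + (Real.log 4 + 4)), fun N => ?_⟩
  have hl4 : 0 ≤ Real.log 4 := Real.log_nonneg (by norm_num)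
  rcases Nat.eq_zero_or_pos N with rfl | hN
  · simp; positivity
  set X := ∑ d ∈ Finset.Ioc 0 N, chi d * vonMangoldt d / d with hX
  have h1 : L * X = ∑ n ∈ Finset.Ioc 0 N, chi n * (Real.log n / n)
      - ∑ d ∈ Finset.Ioc 0 N, chi d * vonMangoldt d / d * (chiB (N / d) - L) := by
    rw [twisted_conv, ← Finset.sum_sub_distrib, hX, Finset.mul_sum]
    exact Finset.sum_congr rfl fun d _ => by ring
  have h2 : |∑ d ∈ Finset.Ioc 0 N, chi d * vonMangoldt d / d * (chiB (N / d) - L)|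
      ≤ Real.log 4 + 4 := by
    calc _ ≤ ∑ d ∈ Finset.Ioc 0 N, |chi d * vonMangoldt d / d * (chiB (N / d) - L)| :=
          Finset.abs_sum_le_sum_abs _ _
      _ ≤ ∑ d ∈ Finset.Ioc 0 N, vonMangoldt d / N := by
          refine Finset.sum_le_sum fun d hd => ?_
          have hd0 : 0 < d := (Finset.mem_Ioc.1 hd).1
          have hdr : (0 : ℝ) < d := by exact_mod_cast hd0
          have hNr : (0 : ℝ) < N := by exact_mod_cast hN
          have hv : 0 ≤ vonMangoldt d := vonMangoldt_nonneg
          rw [abs_mul, abs_div, abs_mul, abs_of_nonneg hv, abs_of_pos hdr]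
          calc |chi d| * vonMangoldt d / d * |chiB (N / d) - L|
              ≤ 1 * vonMangoldt d / d * (d / N) := by
                have := (hB (N / d)).trans (div_succ_bound N d hd0 hN)
                have := chi_abs d
                gcongr
            _ = vonMangoldt d / N := by field_simp
      _ = (∑ d ∈ Finset.Ioc 0 N, vonMangoldt d) / N := by rw [Finset.sum_div]
      _ ≤ Real.log 4 + 4 := by
          rw [div_le_iff₀ (by exact_mod_cast hN)]
          exact psi_sum_le N
  have h3 := chi_log_bound N
  have h4 : L * |X| ≤ 1 + (Real.log 4 + 4) := by
    rw [← abs_of_pos (show 0 < L by linarith), ← abs_mul, h1]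
    exact (abs_sub _ _).trans (by linarith)
  nlinarith [abs_nonneg X]

open ArithmeticFunction in
lemma mertens_one : ∃ K : ℝ, ∀ N : ℕ, 1 ≤ N →
    |∑ d ∈ Finset.Ioc 0 N, vonMangoldt d / d - Real.log N| ≤ K := by
  refine ⟨Real.log 4 + 4, fun N hN => ?_⟩
  have hl4 : 0 ≤ Real.log 4 := Real.log_nonneg (by norm_num)
  have hNr : (0 : ℝ) < N := by exact_mod_cast hN
  have h := sum_Ioc_mul_zeta_eq_sum vonMangoldt N
  rw [vonMangoldt_mul_zeta] at h
  have hf : ∑ n ∈ Finset.Ioc 0 N, ArithmeticFunction.log n = Real.log (N.factorial) := by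
    clear h hN hNr
    induction N with
    | zero => simp
    | succ N ih =>
      rw [Finset.sum_Ioc_succ_top (Nat.zero_le N), ih, Nat.factorial_succ]
      push_cast
      rw [Real.log_mul (by positivity) (by positivity), add_comm]
      simp [ArithmeticFunction.log_apply]
  rw [hf] at h
  have hup : Real.log (N.factorial) ≤ N * Real.log N := by
    rw [← Real.log_pow]
    exact Real.log_le_log (by positivity) (by exact_mod_cast Nat.factorial_le_pow N)
  have hlow : N * Real.log N - N ≤ Real.log (N.factorial) := by
    have := Stirling.le_log_factorial_stirling (n := N) (by omega)
    have h1 : 0 ≤ Real.log N := Real.log_nonneg (by exact_mod_cast hN)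
    have h2 : 0 ≤ Real.log (2 * Real.pi) := Real.log_nonneg (by linarith [Real.pi_gt_three])
    linarith
  have hA : ∑ d ∈ Finset.Ioc 0 N, vonMangoldt d * ((N / d : ℕ) : ℝ)
      ≤ N * ∑ d ∈ Finset.Ioc 0 N, vonMangoldt d / d := by
    rw [Finset.mul_sum]
    refine Finset.sum_le_sum fun d hd => ?_
    have hv : 0 ≤ vonMangoldt d := vonMangoldt_nonneg
    have : ((N / d : ℕ) : ℝ) ≤ N / d := Nat.cast_div_le
    calc _ ≤ vonMangoldt d * ((N : ℝ) / d) := by gcongr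
      _ = _ := by ring
  have hB : N * ∑ d ∈ Finset.Ioc 0 N, vonMangoldt d / d
      ≤ ∑ d ∈ Finset.Ioc 0 N, vonMangoldt d * ((N / d : ℕ) : ℝ)
        + ∑ d ∈ Finset.Ioc 0 N, vonMangoldt d := by
    rw [Finset.mul_sum, ← Finset.sum_add_distrib]
    refine Finset.sum_le_sum fun d hd => ?_
    have hd0 : 0 < d := (Finset.mem_Ioc.1 hd).1
    have hdr : (0 : ℝ) < d := by exact_mod_cast hd0
    have hv : 0 ≤ vonMangoldt d := vonMangoldt_nonneg
    have h : N < d * (N / d + 1) := Nat.lt_mul_div_succ N hd0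
    have h' : (N : ℝ) ≤ d * ((N / d : ℕ) + 1) := by exact_mod_cast h.le
    have h'' : (N : ℝ) / d ≤ (N / d : ℕ) + 1 := by
      rw [div_le_iff₀ hdr]; linarith
    calc (N : ℝ) * (vonMangoldt d / d) = vonMangoldt d * ((N : ℝ) / d) := by ring
      _ ≤ vonMangoldt d * ((N / d : ℕ) + 1) := by gcongr
      _ = _ := by ring
  have hpsi := psi_sum_le N
  set X := ∑ d ∈ Finset.Ioc 0 N, vonMangoldt d / d
  rw [← h] at hA hB
  rw [abs_le]
  constructor
  · have : N * (Real.log N - 1) ≤ N * X := by nlinarith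
    have := le_of_mul_le_mul_left this hNr
    linarith
  · have : N * X ≤ N * (Real.log N + (Real.log 4 + 4)) := by nlinarith
    have := le_of_mul_le_mul_left this hNr
    linarith

noncomputable def aa (n : ℕ) : ℝ := (1 + chi n) * ArithmeticFunction.vonMangoldt n / n

lemma aa_nonneg (n : ℕ) : 0 ≤ aa n := by
  unfold aa
  have := (abs_le.1 (chi_abs n)).1
  have hv : 0 ≤ ArithmeticFunction.vonMangoldt n := ArithmeticFunction.vonMangoldt_nonneg
  have : 0 ≤ 1 + chi n := by linarith
  positivity

open ArithmeticFunction in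
lemma aa_sum : ∃ K : ℝ, 0 ≤ K ∧ ∀ N : ℕ, 1 ≤ N →
    |∑ d ∈ Finset.Ioc 0 N, aa d - Real.log N| ≤ K := by
  obtain ⟨K1, h1⟩ := mertens_one
  obtain ⟨K2, h2⟩ := twisted_mertens
  have key : ∀ N : ℕ, 1 ≤ N → |∑ d ∈ Finset.Ioc 0 N, aa d - Real.log N| ≤ K1 + K2 := by
    intro N hN
    have e : ∑ d ∈ Finset.Ioc 0 N, aa d - Real.log N
      = (∑ d ∈ Finset.Ioc 0 N, vonMangoldt d / d - Real.log N)
        + ∑ d ∈ Finset.Ioc 0 N, chi d * vonMangoldt d / d := by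
      have : ∑ d ∈ Finset.Ioc 0 N, aa d = ∑ d ∈ Finset.Ioc 0 N, vonMangoldt d / d
        + ∑ d ∈ Finset.Ioc 0 N, chi d * vonMangoldt d / d := by
        rw [← Finset.sum_add_distrib]
        exact Finset.sum_congr rfl fun d _ => by unfold aa; ring
      rw [this]; ring
    rw [e]
    exact (abs_add_le _ _).trans (add_le_add (h1 N hN) (h2 N))
  exact ⟨K1 + K2, (abs_nonneg _).trans (key 1 le_rfl), key⟩

open ArithmeticFunction in
lemma mertens_two : ∃ C : ℝ, 0 ≤ C ∧ ∀ M N : ℕ, 2 ≤ M → M ≤ N →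
    ∑ n ∈ Finset.Icc M N, aa n / Real.log n
      ≤ Real.log (Real.log N) - Real.log (Real.log M) + C := by
  obtain ⟨K, hK0, hK⟩ := aa_sum
  have hl2 : 0 < Real.log 2 := Real.log_pos (by norm_num)
  refine ⟨1 + 2 * K / Real.log 2, by positivity, fun M N hM hMN => ?_⟩
  have key : ∑ n ∈ Finset.Icc M N, aa n / Real.log n
      ≤ Real.log (Real.log N) - Real.log (Real.log M)
        + (∑ d ∈ Finset.Ioc 0 N, aa d - Real.log N - K) * (1 / Real.log N)
        + (1 + 2 * K / Real.log 2) := by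
    induction N, hMN using Nat.le_induction with
    | base =>
      have hMr : (2 : ℝ) ≤ M := by exact_mod_cast hM
      have hlM : Real.log 2 ≤ Real.log M := Real.log_le_log (by norm_num) hMr
      have h0 : 0 < Real.log M := by linarith
      have h1 : aa M / Real.log M ≤ 1 := by
        rw [div_le_one h0]
        unfold aa
        have hc := (abs_le.1 (chi_abs M)).2
        have hv : vonMangoldt M ≤ Real.log M := vonMangoldt_le_log
        have hv0 : 0 ≤ vonMangoldt M := vonMangoldt_nonneg
        rw [div_le_iff₀ (by linarith)]
        nlinarith
      have h2 := (abs_le.1 (hK M (by omega))).1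
      have h3 : -(2 * K / Real.log 2) ≤
          (∑ d ∈ Finset.Ioc 0 M, aa d - Real.log M - K) * (1 / Real.log M) := by
        have ha : 2 * K / Real.log M ≤ 2 * K / Real.log 2 := by gcongr
        have hb : -(2 * K) * (1 / Real.log M) ≤
          (∑ d ∈ Finset.Ioc 0 M, aa d - Real.log M - K) * (1 / Real.log M) := by
          gcongr; linarith
        have hc : -(2 * K) * (1 / Real.log M) = -(2 * K / Real.log M) := by ring
        linarith
      simp only [Finset.Icc_self, Finset.sum_singleton]
      linarith
    | succ N hN ih =>
      have hNr : (2 : ℝ) ≤ N := by exact_mod_cast (hM.trans hN)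
      have hlN : Real.log 2 ≤ Real.log N := Real.log_le_log (by norm_num) hNr
      have hlN' : Real.log N ≤ Real.log (N + 1 : ℕ) :=
        Real.log_le_log (by linarith) (by push_cast; linarith)
      have hE := (abs_le.1 (hK N (by omega))).2
      rw [Finset.sum_Icc_succ_top (by omega : M ≤ N + 1),
        Finset.sum_Ioc_succ_top (Nat.zero_le N)]
      set u := Real.log N
      set v := Real.log (N + 1 : ℕ)
      have hu : 0 < u := by linarith
      have hv : 0 < v := by linarith
      set S := ∑ d ∈ Finset.Ioc 0 N, aa d
      have h1 : (v - u) / v ≤ Real.log v - Real.log u := by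
        have := Real.log_le_sub_one_of_pos (x := u / v) (by positivity)
        rw [Real.log_div hu.ne' hv.ne'] at this
        have e : (v - u) / v = 1 - u / v := by field_simp
        linarith
      have h2 : (S - u - K) * (1 / u) ≤ (S - u - K) * (1 / v) := by
        have : 1 / v ≤ 1 / u := one_div_le_one_div_of_le hu hlN'
        nlinarith
      have e : (S + aa (N + 1) - v - K) * (1 / v)
        = (S - u - K) * (1 / v) + aa (N + 1) / v - (v - u) / v := by
        field_simp; ring
      rw [e]
      linarith
  have hNr : (2 : ℝ) ≤ N := by exact_mod_cast (hM.trans hMN)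
  have h0 : 0 < Real.log N := Real.log_pos (by linarith)
  have hE := (abs_le.1 (hK N (by omega))).2
  have : (∑ d ∈ Finset.Ioc 0 N, aa d - Real.log N - K) * (1 / Real.log N) ≤ 0 :=
    mul_nonpos_of_nonpos_of_nonneg (by linarith) (by positivity)
  linarith

open GaussianInt in
lemma prime_class (P : Ideal GaussianInt) (hP0 : P ≠ ⊥) (hP : P.IsPrime) :
    ∃ p : ℕ, p.Prime ∧
      ((Nat.card (GaussianInt ⧸ P) = p ∧
          ∃ r : { r : ZMod p // r * r = ((-1 : ℤ) : ZMod p) }, P = RingHom.ker (Zsqrtd.lift r)) ∨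
        (Nat.card (GaussianInt ⧸ P) = p ^ 2 ∧ P = Ideal.span {(p : GaussianInt)})) := by
  have hdom : IsDomain (GaussianInt ⧸ P) := Ideal.Quotient.isDomain P
  obtain ⟨x, hxP, hx0⟩ := Submodule.exists_mem_ne_zero_of_ne_bot hP0
  obtain ⟨p, hp⟩ := CharP.exists (GaussianInt ⧸ P)
  let q : GaussianInt →+* GaussianInt ⧸ P := Ideal.Quotient.mk P
  have hq : ∀ a, q a = 0 ↔ a ∈ P := fun a => Ideal.Quotient.eq_zero_iff_mem
  have hn : ((x.norm : ℤ) : GaussianInt ⧸ P) = 0 := by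
    rw [← map_intCast q, hq, Zsqrtd.norm_eq_mul_conj]
    exact P.mul_mem_right _ hxP
  have hp0 : p ≠ 0 := by
    rintro rfl
    rw [CharP.intCast_eq_zero_iff (GaussianInt ⧸ P) 0] at hn
    exact hx0 (GaussianInt.norm_eq_zero.1 (by simpa using zero_dvd_iff.1 hn))
  have hpp : p.Prime := (CharP.char_is_prime_or_zero (GaussianInt ⧸ P) p).resolve_right hp0
  have : Fact p.Prime := ⟨hpp⟩
  let ι : ZMod p →+* GaussianInt ⧸ P := ZMod.castHom dvd_rfl _
  have hι : Function.Injective ι := ι.injective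
  let s : GaussianInt ⧸ P := q Zsqrtd.sqrtd
  have hqa : ∀ a : GaussianInt, q a = ι (a.re : ZMod p) + ι (a.im : ZMod p) * s := by
    intro a
    have : a = (a.re : GaussianInt) + Zsqrtd.sqrtd * (a.im : GaussianInt) := Zsqrtd.decompose
    conv_lhs => rw [this]
    rw [map_add, map_mul, map_intCast, map_intCast, map_intCast, map_intCast]
    ring
  have hss : s * s = -1 := by
    have : (Zsqrtd.sqrtd : GaussianInt) * Zsqrtd.sqrtd = ((-1 : ℤ) : GaussianInt) := Zsqrtd.dmuld
    rw [← map_mul, this, map_intCast]; simp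
  have hsurj : Function.Surjective (fun c : ZMod p × ZMod p => ι c.1 + ι c.2 * s) := by
    intro y
    obtain ⟨a, rfl⟩ := Ideal.Quotient.mk_surjective y
    exact ⟨(a.re, a.im), (hqa a).symm⟩
  have : Finite (GaussianInt ⧸ P) := Finite.of_surjective _ hsurj
  refine ⟨p, hpp, ?_⟩
  by_cases hr : ∃ r, ι r = s
  · left
    obtain ⟨r, hr⟩ := hr
    have hbij : Function.Bijective ι := by
      refine ⟨hι, fun y => ?_⟩
      obtain ⟨c, hc⟩ := hsurj y
      exact ⟨c.1 + c.2 * r, by rw [map_add, map_mul, hr]; exact hc⟩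
    constructor
    · rw [← Nat.card_eq_of_bijective ι hbij, Nat.card_zmod]
    · refine ⟨⟨r, ?_⟩, ?_⟩
      · apply hι
        rw [map_mul, hr, hss]; simp
      · ext a
        have e : q a = ι ((a.re : ZMod p) + (a.im : ZMod p) * r) := by
          rw [hqa, map_add, map_mul, hr]
        rw [← hq, RingHom.mem_ker, e, map_eq_zero_iff ι hι]
        rfl
  · right
    push Not at hr
    have hind : ∀ a b : ZMod p, ι a + ι b * s = 0 → a = 0 ∧ b = 0 := by
      intro a b hab
      have hb : b = 0 := by
        by_contra hb
        apply hr (-a * b⁻¹)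
        have h1 : ι b * ι (b⁻¹) = 1 := by rw [← map_mul, mul_inv_cancel₀ hb, map_one]
        rw [map_mul, map_neg]
        linear_combination (-ι b⁻¹) * hab + s * h1
      subst hb
      simp at hab
      exact ⟨by simpa using hab, rfl⟩
    constructor
    · have hinj : Function.Injective (fun c : ZMod p × ZMod p => ι c.1 + ι c.2 * s) := by
        rintro ⟨a, b⟩ ⟨c, d⟩ h
        simp only at h
        have := hind (a - c) (b - d) (by rw [map_sub, map_sub]; linear_combination h)
        rw [sub_eq_zero, sub_eq_zero] at this
        rw [this.1, this.2]
      rw [← Nat.card_eq_of_bijective _ ⟨hinj, hsurj⟩, Nat.card_prod, Nat.card_zmod, sq]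
    · ext a
      rw [Ideal.mem_span_singleton, ← hq, hqa]
      have : ((p : ℕ) : GaussianInt) = ((p : ℤ) : GaussianInt) := by simp
      rw [this, Zsqrtd.intCast_dvd, ← ZMod.intCast_zmod_eq_zero_iff_dvd,
        ← ZMod.intCast_zmod_eq_zero_iff_dvd]
      constructor
      · exact hind _ _
      · rintro ⟨h1, h2⟩
        rw [h1, h2]; simp


lemma card_roots (p : ℕ) (hp : p.Prime) :
    ∃ _ : Fintype { r : ZMod p // r * r = ((-1 : ℤ) : ZMod p) },
    (Fintype.card { r : ZMod p // r * r = ((-1 : ℤ) : ZMod p) } : ℝ) ≤ 1 + chi p := by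
  have : Fact p.Prime := ⟨hp⟩
  have key : ∀ r s : ZMod p, r * r = ((-1 : ℤ) : ZMod p) → s * s = ((-1 : ℤ) : ZMod p) →
      s = r ∨ s = -r := by
    intro r s hr hs
    exact mul_self_eq_mul_self_iff.1 (hs.trans hr.symm)
  classical
  refine ⟨inferInstance, ?_⟩
  rw [Fintype.card_subtype]
  rcases hp.eq_two_or_odd with rfl | hodd
  · have h1 : chi 2 = 0 := by
      have : ZMod.χ₄ ((2:ℕ) : ZMod 4) = 0 := by decide
      simp only [chi, this]; simp
    rw [h1]
    have : (Finset.univ.filter fun r : ZMod 2 => r * r = ((-1 : ℤ) : ZMod 2)).card ≤ 1 := by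
      rw [Finset.card_le_one]
      intro r hr s hs
      have h2 : ∀ r : ZMod 2, -r = r := fun r => CharTwo.neg_eq r
      have := key s r (Finset.mem_filter.1 hs).2 (Finset.mem_filter.1 hr).2
      rwa [h2, or_self] at this
    have : ((Finset.univ.filter fun r : ZMod 2 => r * r = ((-1 : ℤ) : ZMod 2)).card : ℝ) ≤ 1 := by
      exact_mod_cast this
    linarith
  · have h4 : p % 4 = 1 ∨ p % 4 = 3 := by omega
    rcases h4 with h4 | h4
    · have : chi p = 1 := by simp only [chi, ZMod.χ₄_nat_one_mod_four h4]; simp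
      rw [this]
      have hle : (Finset.univ.filter fun r : ZMod p => r * r = ((-1 : ℤ) : ZMod p)).card ≤ 2 := by
        by_cases h : ∃ r : ZMod p, r * r = ((-1 : ℤ) : ZMod p)
        · obtain ⟨r, hr⟩ := h
          refine (Finset.card_le_card (t := {r, -r}) ?_).trans Finset.card_le_two
          intro s hs
          have := key r s hr (Finset.mem_filter.1 hs).2
          simpa using this
        · rw [Finset.card_eq_zero.2]
          · norm_num
          · rw [Finset.filter_eq_empty_iff]
            intro r _ hr
            exact h ⟨r, hr⟩
      have : ((Finset.univ.filter fun r : ZMod p => r * r = ((-1 : ℤ) : ZMod p)).card : ℝ) ≤ 2 := by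
        exact_mod_cast hle
      linarith
    · have : chi p = -1 := by simp only [chi, ZMod.χ₄_nat_three_mod_four h4]; simp
      rw [this, Finset.card_eq_zero.2]
      · simp
      · rw [Finset.filter_eq_empty_iff]
        intro r _ hr
        exact (ZMod.exists_sq_eq_neg_one_iff (p := p)).1 ⟨r, by rw [hr]; simp⟩ h4

/-- number of prime ideals of norm `p` -/
lemma card_norm_prime (T : Finset (Ideal GaussianInt)) (p : ℕ) (hp : p.Prime)
    (hT : ∀ P ∈ T, P ≠ ⊥ ∧ P.IsPrime ∧ Nat.card (GaussianInt ⧸ P) = p) :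
    (T.card : ℝ) ≤ 1 + chi p := by
  obtain ⟨_, h⟩ := card_roots p hp
  refine le_trans ?_ h
  have hex : ∀ P : Ideal GaussianInt, P ∈ T →
      ∃ r : { r : ZMod p // r * r = ((-1 : ℤ) : ZMod p) }, P = RingHom.ker (Zsqrtd.lift r) := by
    intro P hPT
    obtain ⟨h0, h1, h2⟩ := hT P hPT
    obtain ⟨p', hp', ⟨hc, hr⟩ | ⟨hc, -⟩⟩ := prime_class P h0 h1
    · obtain rfl : p = p' := h2.symm.trans hc
      exact hr
    · exfalso
      rw [h2.symm.trans hc] at hp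
      exact Nat.Prime.not_prime_pow le_rfl hp
  classical
  have hsub : T ⊆ Finset.univ.image fun r : { r : ZMod p // r * r = ((-1 : ℤ) : ZMod p) } =>
      RingHom.ker (Zsqrtd.lift r) := by
    intro P hPT
    obtain ⟨r, hr⟩ := hex P hPT
    exact Finset.mem_image.2 ⟨r, Finset.mem_univ _, hr.symm⟩
  exact_mod_cast (Finset.card_le_card hsub).trans Finset.card_image_le

noncomputable abbrev nn (P : Ideal GaussianInt) : ℕ := Nat.card (GaussianInt ⧸ P)

lemma two_le_nn (P : Ideal GaussianInt) (hP0 : P ≠ ⊥) (hP : P.IsPrime) : 2 ≤ nn P := by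
  obtain ⟨p, hp, ⟨hc, -⟩ | ⟨hc, -⟩⟩ := prime_class P hP0 hP
  · exact hp.two_le.trans hc.ge
  · have := hp.two_le
    change 2 ≤ Nat.card (GaussianInt ⧸ P)
    rw [hc]; nlinarith

lemma sum_sq_le (s : Finset ℕ) :
    ∑ n ∈ s, 1 / (n : ℝ) ^ 2 ≤ ∑' n : ℕ, 1 / (n : ℝ) ^ 2 :=
  (Real.summable_one_div_nat_pow.2 (by norm_num)).sum_le_tsum s (fun n _ => by positivity)

/-- contribution of the inert primes -/
lemma sum_inert (T : Finset (Ideal GaussianInt))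
    (hT : ∀ P ∈ T, P ≠ ⊥ ∧ P.IsPrime ∧ ¬ (nn P).Prime) :
    ∑ P ∈ T, 1 / (nn P : ℝ) ≤ ∑' n : ℕ, 1 / (n : ℝ) ^ 2 := by
  classical
  have hex : ∀ P : Ideal GaussianInt, ∃ p : ℕ, P ∈ T →
      nn P = p ^ 2 ∧ P = Ideal.span {(p : GaussianInt)} := by
    intro P
    by_cases hPT : P ∈ T
    · obtain ⟨h0, h1, h2⟩ := hT P hPT
      obtain ⟨p, hp, ⟨hc, -⟩ | h⟩ := prime_class P h0 h1
      · exact absurd (by rw [show nn P = p from hc]; exact hp) h2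
      · exact ⟨p, fun _ => h⟩
    · exact ⟨0, fun h => absurd h hPT⟩
  choose f hf using hex
  have hinj : Set.InjOn f T := by
    intro P hP Q hQ h
    rw [(hf P hP).2, (hf Q hQ).2, h]
  calc ∑ P ∈ T, 1 / (nn P : ℝ) = ∑ P ∈ T, 1 / ((f P : ℕ) : ℝ) ^ 2 :=
        Finset.sum_congr rfl fun P hP => by rw [(hf P hP).1]; push_cast; rfl
    _ = ∑ n ∈ T.image f, 1 / (n : ℝ) ^ 2 := (Finset.sum_image (f := fun n : ℕ => 1 / (n : ℝ) ^ 2) hinj).symm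
    _ ≤ _ := sum_sq_le _

lemma sum_fiber (T : Finset (Ideal GaussianInt)) (M N : ℕ) (g : ℕ → ℝ) (hg : ∀ n, 0 ≤ g n)
    (hT : ∀ P ∈ T, P ≠ ⊥ ∧ P.IsPrime ∧ (nn P).Prime ∧ M ≤ nn P ∧ nn P ≤ N) :
    ∑ P ∈ T, g (nn P) ≤ ∑ n ∈ Finset.Icc M N, if n.Prime then (1 + chi n) * g n else 0 := by
  classical
  rw [← Finset.sum_fiberwise_of_maps_to (s := T) (t := Finset.Icc M N) (g := nn)
    (fun P hP => Finset.mem_Icc.2 ⟨(hT P hP).2.2.2.1, (hT P hP).2.2.2.2⟩)]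
  refine Finset.sum_le_sum fun n hn => ?_
  have e : ∑ P ∈ T with nn P = n, g (nn P) = ((T.filter fun P => nn P = n).card : ℝ) * g n := by
    rw [← nsmul_eq_mul, ← Finset.sum_const]
    exact Finset.sum_congr rfl fun P hP => by rw [(Finset.mem_filter.1 hP).2]
  rw [e]
  split_ifs with hp
  · refine mul_le_mul_of_nonneg_right ?_ (hg n)
    refine card_norm_prime _ n hp fun P hP => ?_
    have := Finset.mem_filter.1 hP
    exact ⟨(hT P this.1).1, (hT P this.1).2.1, this.2⟩
  · rw [Finset.card_eq_zero.2]
    · simp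
    · rw [Finset.filter_eq_empty_iff]
      intro P hP h
      exact hp (h ▸ (hT P hP).2.2.1)

lemma sum_main : ∃ C : ℝ, 0 ≤ C ∧ ∀ (M N : ℕ), 2 ≤ M → M ≤ N → ∀ T : Finset (Ideal GaussianInt),
    (∀ P ∈ T, P ≠ ⊥ ∧ P.IsPrime ∧ M ≤ nn P ∧ nn P ≤ N) →
    ∑ P ∈ T, (2 / (nn P : ℝ) + 21 / (nn P : ℝ) ^ 2)
      ≤ 2 * (Real.log (Real.log N) - Real.log (Real.log M)) + C := by
  obtain ⟨C, hC0, hC⟩ := mertens_two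
  set Z := ∑' n : ℕ, 1 / (n : ℝ) ^ 2 with hZ
  have hZ0 : 0 ≤ Z := tsum_nonneg fun n => by positivity
  refine ⟨2 * C + 42 * Z + 23 * Z, by positivity, fun M N hM hMN T hT => ?_⟩
  classical
  rw [← Finset.sum_filter_add_sum_filter_not T (fun P => (nn P).Prime)]
  have h2 : ∑ P ∈ T with ¬ (nn P).Prime, (2 / (nn P : ℝ) + 21 / (nn P : ℝ) ^ 2) ≤ 23 * Z := by
    have h := sum_inert (T.filter fun P => ¬ (nn P).Prime) (fun P hP => by
      have := Finset.mem_filter.1 hP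
      exact ⟨(hT P this.1).1, (hT P this.1).2.1, this.2⟩)
    calc _ ≤ ∑ P ∈ T with ¬ (nn P).Prime, 23 * (1 / (nn P : ℝ)) := by
          refine Finset.sum_le_sum fun P hP => ?_
          have := Finset.mem_filter.1 hP
          have h2 : (1 : ℝ) ≤ nn P := by
            exact_mod_cast (show 1 ≤ nn P by have := (hT P this.1).2.2.1; omega)
          have : 1 / (nn P : ℝ) ^ 2 ≤ 1 / (nn P : ℝ) :=
            one_div_le_one_div_of_le (by linarith) (by nlinarith)
          have e1 : 2 / (nn P : ℝ) = 2 * (1 / (nn P : ℝ)) := by ring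
          have e2 : 21 / (nn P : ℝ) ^ 2 = 21 * (1 / (nn P : ℝ) ^ 2) := by ring
          rw [e1, e2]; linarith
      _ ≤ 23 * Z := by rw [← Finset.mul_sum]; linarith
  have hT1 : ∀ P ∈ T.filter (fun P => (nn P).Prime),
      P ≠ ⊥ ∧ P.IsPrime ∧ (nn P).Prime ∧ M ≤ nn P ∧ nn P ≤ N := by
    intro P hP
    have := Finset.mem_filter.1 hP
    obtain ⟨a, b, c, d⟩ := hT P this.1
    exact ⟨a, b, this.2, c, d⟩
  have h1 : ∑ P ∈ T with (nn P).Prime, (2 / (nn P : ℝ)) ≤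
      2 * (Real.log (Real.log N) - Real.log (Real.log M) + C) := by
    refine (sum_fiber _ M N (fun n => 2 / (n : ℝ)) (fun n => by positivity) hT1).trans ?_
    refine le_trans ?_ (mul_le_mul_of_nonneg_left (hC M N hM hMN) (by norm_num))
    rw [Finset.mul_sum]
    refine Finset.sum_le_sum fun n hn => ?_
    have hn2 : 2 ≤ n := hM.trans (Finset.mem_Icc.1 hn).1
    have hl : 0 < Real.log n := Real.log_pos (by exact_mod_cast hn2)
    split_ifs with hp
    · unfold aa
      rw [ArithmeticFunction.vonMangoldt_apply_prime hp]
      apply le_of_eq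
      have : (n : ℝ) ≠ 0 := by positivity
      field_simp
    · have := aa_nonneg n
      positivity
  have h3 : ∑ P ∈ T with (nn P).Prime, (21 / (nn P : ℝ) ^ 2) ≤ 42 * Z := by
    refine (sum_fiber _ M N (fun n => 21 / (n : ℝ) ^ 2) (fun n => by positivity) hT1).trans ?_
    refine le_trans ?_ (mul_le_mul_of_nonneg_left (sum_sq_le (Finset.Icc M N)) (by norm_num))
    rw [Finset.mul_sum]
    refine Finset.sum_le_sum fun n hn => ?_
    split_ifs with hp
    · have := (abs_le.1 (chi_abs n)).2
      calc (1 + chi n) * (21 / (n : ℝ) ^ 2) ≤ 2 * (21 / (n : ℝ) ^ 2) := by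
            gcongr; linarith
        _ = 42 * (1 / (n : ℝ) ^ 2) := by ring
    · positivity
  rw [Finset.sum_add_distrib]
  linarith

/-- the local factor -/
lemma factor_bound (N : ℕ) (hN : 2 ≤ N) (b : ℝ)
    (hb : b = if 2 < N then (2 / (N : ℝ)) * (1 + 1 / ((N : ℝ) ^ 2 - 1))
      else (1 / (N : ℝ)) * (1 + 1 / ((N : ℝ) ^ 2 - 1))) :
    0 < b ∧ b < 1 ∧ (1 - b)⁻¹ ≤ Real.exp (2 / (N : ℝ) + 21 / (N : ℝ) ^ 2) := by
  by_cases h : 2 < N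
  · rw [if_pos h] at hb
    have hN3 : (3 : ℝ) ≤ N := by exact_mod_cast h
    set x : ℝ := (N : ℝ) with hx
    clear_value x
    have h1 : 0 < x ^ 2 - 1 := by nlinarith
    have h2 : 0 < x ^ 2 - 2 * x - 1 := by nlinarith
    have e : b = 2 * x / (x ^ 2 - 1) := by
      rw [hb]; field_simp; ring
    have hpos : 0 < b := by rw [e]; positivity
    have e1 : 1 - b = (x ^ 2 - 2 * x - 1) / (x ^ 2 - 1) := by rw [e]; field_simp; ring
    have hlt : 0 < 1 - b := by rw [e1]; positivity
    refine ⟨hpos, by linarith, ?_⟩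
    have e2 : (1 - b)⁻¹ = 2 * x / (x ^ 2 - 2 * x - 1) + 1 := by
      rw [e1, inv_div, div_add_one h2.ne']
      congr 1; ring
    rw [e2]
    refine le_trans ?_ (Real.add_one_le_exp _)
    have e3 : 2 / x + 21 / x ^ 2 = (2 * x + 21) / x ^ 2 := by field_simp
    rw [e3, add_le_add_iff_right, div_le_div_iff₀ h2 (by positivity)]
    nlinarith
  · have hN2 : N = 2 := by omega
    subst hN2
    norm_num at hb
    subst hb
    refine ⟨by norm_num, by norm_num, ?_⟩
    refine le_trans ?_ (Real.add_one_le_exp _)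
    norm_num

theorem stmt6 (β : Ideal GaussianInt → ℝ)
    (hβ : ∀ 𝔭 : Ideal GaussianInt, 𝔭 ≠ ⊥ → 𝔭.IsPrime →
      β 𝔭 = if 2 < Nat.card (GaussianInt ⧸ 𝔭) then
          (2 / (Nat.card (GaussianInt ⧸ 𝔭) : ℝ)) *
            (1 + 1 / ((Nat.card (GaussianInt ⧸ 𝔭) : ℝ) ^ 2 - 1))
        else
          (1 / (Nat.card (GaussianInt ⧸ 𝔭) : ℝ)) *
            (1 + 1 / ((Nat.card (GaussianInt ⧸ 𝔭) : ℝ) ^ 2 - 1))) :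
    (∀ 𝔭 : Ideal GaussianInt, 𝔭 ≠ ⊥ → 𝔭.IsPrime → 0 < β 𝔭 ∧ β 𝔭 < 1) ∧
    ∃ C > (0 : ℝ), ∀ w z : ℝ, 2 ≤ w → w < z →
      (∏ᶠ 𝔭 ∈ {𝔭 : Ideal GaussianInt | 𝔭 ≠ ⊥ ∧ 𝔭.IsPrime ∧
          w ≤ (Nat.card (GaussianInt ⧸ 𝔭) : ℝ) ∧ (Nat.card (GaussianInt ⧸ 𝔭) : ℝ) < z},
        (1 - β 𝔭)⁻¹)
        ≤ C * (Real.log z / Real.log w) ^ 2 := by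
  have hfac := fun (P : Ideal GaussianInt) (h0 : P ≠ ⊥) (h1 : P.IsPrime) =>
    factor_bound (nn P) (two_le_nn P h0 h1) (β P) (hβ P h0 h1)
  refine ⟨fun P h0 h1 => ⟨(hfac P h0 h1).1, (hfac P h0 h1).2.1⟩, ?_⟩
  obtain ⟨C, hC0, hC⟩ := sum_main
  refine ⟨Real.exp C, Real.exp_pos _, fun w z hw hwz => ?_⟩
  have hlw : 0 < Real.log w := Real.log_pos (by linarith)
  have hlwz : Real.log w < Real.log z := Real.log_lt_log (by linarith) hwz
  have hlz : 0 < Real.log z := by linarith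
  have hE : Real.exp C * (Real.log z / Real.log w) ^ 2
      = Real.exp (2 * (Real.log (Real.log z) - Real.log (Real.log w)) + C) := by
    rw [add_comm, Real.exp_add, ← Real.log_div hlz.ne' hlw.ne', mul_comm 2, Real.exp_mul,
      Real.exp_log (by positivity)]
    norm_num
  have hll : Real.log (Real.log w) ≤ Real.log (Real.log z) := Real.log_le_log hlw hlwz.le
  have hone : 1 ≤ Real.exp C * (Real.log z / Real.log w) ^ 2 := by
    rw [hE]; exact Real.one_le_exp (by linarith)
  set S := {𝔭 : Ideal GaussianInt | 𝔭 ≠ ⊥ ∧ 𝔭.IsPrime ∧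
          w ≤ (Nat.card (GaussianInt ⧸ 𝔭) : ℝ) ∧ (Nat.card (GaussianInt ⧸ 𝔭) : ℝ) < z} with hS
  by_cases hfin : (S ∩ Function.mulSupport fun P => (1 - β P)⁻¹).Finite
  swap
  · rw [finprod_mem_eq_one_of_infinite hfin]; exact hone
  rw [finprod_mem_eq_prod _ hfin]
  have hT : ∀ P ∈ hfin.toFinset, P ∈ S := fun P hP => ((Set.Finite.mem_toFinset _).1 hP).1
  generalize hfin.toFinset = T at hT
  rcases T.eq_empty_or_nonempty with rfl | ⟨P0, hP0⟩
  · simpa using hone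
  have hprod : ∏ P ∈ T, (1 - β P)⁻¹
      ≤ Real.exp (∑ P ∈ T, (2 / (nn P : ℝ) + 21 / (nn P : ℝ) ^ 2)) := by
    rw [Real.exp_sum]
    refine Finset.prod_le_prod (fun P hP => ?_) (fun P hP => ?_)
    · have := (hfac P (hT P hP).1 (hT P hP).2.1).2.1
      exact inv_nonneg.2 (by linarith)
    · exact (hfac P (hT P hP).1 (hT P hP).2.1).2.2
  refine hprod.trans ?_
  rw [hE, Real.exp_le_exp]
  have hz0 : 0 ≤ z := by linarith
  have hb : ∀ P ∈ T, P ≠ ⊥ ∧ P.IsPrime ∧ ⌈w⌉₊ ≤ nn P ∧ nn P ≤ ⌊z⌋₊ := by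
    intro P hP
    obtain ⟨a, b, c, d⟩ := hT P hP
    exact ⟨a, b, Nat.ceil_le.2 c, Nat.le_floor d.le⟩
  have hM2 : 2 ≤ ⌈w⌉₊ := by
    have : (2 : ℝ) ≤ (⌈w⌉₊ : ℝ) := hw.trans (Nat.le_ceil w)
    exact_mod_cast this
  have hMN : ⌈w⌉₊ ≤ ⌊z⌋₊ := (hb P0 hP0).2.2.1.trans (hb P0 hP0).2.2.2
  have h := hC ⌈w⌉₊ ⌊z⌋₊ hM2 hMN T hb
  have hwM : Real.log (Real.log w) ≤ Real.log (Real.log ⌈w⌉₊) :=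
    Real.log_le_log hlw (Real.log_le_log (by linarith) (Nat.le_ceil w))
  have hN2 : (2 : ℝ) ≤ (⌊z⌋₊ : ℝ) := by exact_mod_cast hM2.trans hMN
  have hzN : Real.log (Real.log ⌊z⌋₊) ≤ Real.log (Real.log z) :=
    Real.log_le_log (Real.log_pos (by linarith))
      (Real.log_le_log (by linarith) (Nat.floor_le hz0))
  linarith
end
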